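/- Rapid mixing for large subspaces: Let n ≥ 1, let S be a subspace of (ℂ²)^{⊗n} with orthogonal projector Π_S such that dim S = e^{−s²/2} · 2^n for some s ≥ 0, and set ρ_S = Π_S / dim S. Let M ∈ M_{2^n} satisfy 0 ≤ M ≤ I and τ(M) = e^{−t²/2} for some t ≥ 0, and let 0 ≤ γ < 1. Then Tr(M · D_γ^{⊗n}(ρ_S)) ≥ exp( −(1/2) ( (s² + 2γst + t²)/(1−γ²) − s² ) ). -/

import Mathlib

open Matrix
open scoped ComplexOrder

noncomputable section

/-- Apply a real function to a Hermitian matrix via the functional calculus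
(junk value `0` on non-Hermitian matrices). -/
def hermFC {ι : Type*} [Fintype ι] [DecidableEq ι] (φ : ℝ → ℝ)
    (f : Matrix ι ι ℂ) : Matrix ι ι ℂ :=
  if hf : f.IsHermitian then
    (hf.eigenvectorUnitary : Matrix ι ι ℂ) *
      Matrix.diagonal (fun i => (φ (hf.eigenvalues i) : ℂ)) *
      (star hf.eigenvectorUnitary : Matrix ι ι ℂ)
  else 0

/-- Real matrix powers of a Hermitian matrix, via the functional calculus on eigenvalues. -/
def mpow {ι : Type*} [Fintype ι] [DecidableEq ι] (f : Matrix ι ι ℂ) (a : ℝ) :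
    Matrix ι ι ℂ :=
  hermFC (fun x => x ^ a) f

/-- The normalized trace `τ(f) = Tr f / d` (real part). -/
def ntrace {ι : Type*} [Fintype ι] [DecidableEq ι] (f : Matrix ι ι ℂ) : ℝ :=
  (f.trace).re / (Fintype.card ι)

/-- Normalized Schatten p-'norm': `‖f‖_p = ((1/d) Tr |f|^p)^(1/p)` with `|f| = √(f† f)`. -/
def snorm {ι : Type*} [Fintype ι] [DecidableEq ι] (p : ℝ) (f : Matrix ι ι ℂ) : ℝ :=
  (ntrace (mpow (fᴴ * f) (p / 2))) ^ (1 / p)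

/-- The entropy `Ent(f) = τ(f ln f) − τ(f) ln τ(f)`. -/
def mEnt {ι : Type*} [Fintype ι] [DecidableEq ι] (f : Matrix ι ι ℂ) : ℝ :=
  ntrace (hermFC (fun x => x * Real.log x) f) - ntrace f * Real.log (ntrace f)

/-- The Dirichlet form `E_L(f,g) = τ(f L(g))`. -/
def dirichlet {ι : Type*} [Fintype ι] [DecidableEq ι]
    (L : Matrix ι ι ℂ → Matrix ι ι ℂ) (f g : Matrix ι ι ℂ) : ℝ :=
  ntrace (f * L g)

/-- Complete positivity: every matrix extension `id_m ⊗ T` maps PSD matrices to PSD matrices. -/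
def IsCompletelyPositive {ι : Type*} [Fintype ι] [DecidableEq ι]
    (T : Matrix ι ι ℂ → Matrix ι ι ℂ) : Prop :=
  ∀ (m : ℕ) (M : Matrix (Fin m × ι) (Fin m × ι) ℂ), M.PosSemidef →
    (Matrix.of fun p q : Fin m × ι =>
      T (Matrix.of fun i j : ι => M (p.1, i) (q.1, j)) p.2 q.2).PosSemidef

/-- A quantum channel: a linear, completely positive, trace-preserving map. -/
def IsQChannel {ι : Type*} [Fintype ι] [DecidableEq ι]
    (T : Matrix ι ι ℂ → Matrix ι ι ℂ) : Prop :=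
  IsLinearMap ℂ T ∧ IsCompletelyPositive T ∧ ∀ f, (T f).trace = f.trace

/-- Reversibility (detailed balance w.r.t. the trace): `τ(f T(g)) = τ(T(f) g)`. -/
def IsReversible {ι : Type*} [Fintype ι] [DecidableEq ι]
    (T : Matrix ι ι ℂ → Matrix ι ι ℂ) : Prop :=
  ∀ f g : Matrix ι ι ℂ, (f * T g).trace = (T f * g).trace

/-- Primitivity: iterates of `T` converge on every density matrix to a fixed
full-rank state independent of the input. -/
def IsPrimitive {ι : Type*} [Fintype ι] [DecidableEq ι]
    (T : Matrix ι ι ℂ → Matrix ι ι ℂ) : Prop :=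
  ∃ σ : Matrix ι ι ℂ, σ.PosDef ∧ σ.trace = 1 ∧
    ∀ ρ : Matrix ι ι ℂ, ρ.PosSemidef → ρ.trace = 1 →
      Filter.Tendsto (fun k => T^[k] ρ) Filter.atTop (nhds σ)

/-- The depolarizing channel with parameter `γ` applied to the `k`-th qubit of `n` qubits:
`D_γ(f) = γ f + (1−γ) (tr_k f) ⊗_k (I/2)`. -/
def depolAt {n : ℕ} (γ : ℝ) (k : Fin n)
    (f : Matrix (Fin n → Fin 2) (Fin n → Fin 2) ℂ) :
    Matrix (Fin n → Fin 2) (Fin n → Fin 2) ℂ :=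
  Matrix.of fun x y =>
    (γ : ℂ) * f x y +
      ((1 - γ : ℝ) : ℂ) *
        (if x k = y k then
          (1 / 2) * ∑ b : Fin 2, f (Function.update x k b) (Function.update y k b)
        else 0)

/-- The tensor power `D_γ^{⊗n}` of the qubit depolarizing channel, acting on `n` qubits. -/
def depolChannel {n : ℕ} (γ : ℝ)
    (f : Matrix (Fin n → Fin 2) (Fin n → Fin 2) ℂ) :
    Matrix (Fin n → Fin 2) (Fin n → Fin 2) ℂ :=
  (List.finRange n).foldl (fun g k => depolAt γ k g) f

/-- The semigroup element `e^{−tL}` applied to `f`, defined by its power series. -/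
def opExp {ι : Type*} [Fintype ι] [DecidableEq ι]
    (L : Matrix ι ι ℂ → Matrix ι ι ℂ) (t : ℝ) (f : Matrix ι ι ℂ) : Matrix ι ι ℂ :=
  ∑' k : ℕ, (((-t) ^ k / (Nat.factorial k) : ℝ) : ℂ) • L^[k] f

/-- The classical noise operator `T_γ` on functions on the boolean cube:
each bit is flipped independently with probability `(1−γ)/2`. -/
def noiseOp {n : ℕ} (γ : ℝ) (f : (Fin n → Fin 2) → ℝ) : (Fin n → Fin 2) → ℝ :=
  fun x => ∑ y : Fin n → Fin 2,
    (∏ i : Fin n, if y i = x i then (1 + γ) / 2 else (1 - γ) / 2) * f y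

/-- The normalized `ℓ_p` 'norm' `‖f‖_p = (2^{-n} Σ_x |f(x)|^p)^{1/p}` on the boolean cube. -/
def lpnorm {n : ℕ} (p : ℝ) (f : (Fin n → Fin 2) → ℝ) : ℝ :=
  ((∑ x : Fin n → Fin 2, |f x| ^ p) / 2 ^ n) ^ (1 / p)

end

section Spectral

variable {ι : Type*} [Fintype ι]

/-- The real part of the trace. -/
def rtr (f : Matrix ι ι ℂ) : ℝ := f.trace.re

lemma rtr_add (f g : Matrix ι ι ℂ) : rtr (f + g) = rtr f + rtr g := by simp [rtr]

lemma rtr_sub (f g : Matrix ι ι ℂ) : rtr (f - g) = rtr f - rtr g := by simp [rtr]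

lemma rtr_smul (c : ℝ) (f : Matrix ι ι ℂ) : rtr ((c : ℂ) • f) = c * rtr f := by
  simp [rtr]

lemma rtr_mul_comm (f g : Matrix ι ι ℂ) : rtr (f * g) = rtr (g * f) := by
  rw [rtr, rtr, Matrix.trace_mul_comm]

lemma rtr_sum {κ : Type*} (s : Finset κ) (f : κ → Matrix ι ι ℂ) :
    rtr (∑ k ∈ s, f k) = ∑ k ∈ s, rtr (f k) := by
  simp [rtr, Matrix.trace_sum]

/-- The overlap `|⟨u_i, v_j⟩|²` of the columns of two matrices. -/
def overlap (U V : Matrix ι ι ℂ) (i j : ι) : ℝ := Complex.normSq ((Uᴴ * V) i j)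

lemma overlap_nonneg (U V : Matrix ι ι ℂ) (i j : ι) : 0 ≤ overlap U V i j :=
  Complex.normSq_nonneg _

lemma overlap_comm (U V : Matrix ι ι ℂ) (i j : ι) : overlap U V i j = overlap V U j i := by
  have h : (Uᴴ * V) i j = star ((Vᴴ * U) j i) := by
    rw [← conjTranspose_apply, conjTranspose_mul, conjTranspose_conjTranspose]
  rw [overlap, overlap, h, Complex.star_def, Complex.normSq_conj]

variable [DecidableEq ι]

/-- The matrix `U diag(x) U†`. -/
def conjDiag (U : Matrix ι ι ℂ) (x : ι → ℝ) : Matrix ι ι ℂ :=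
  U * diagonal (fun i => (x i : ℂ)) * Uᴴ

lemma unitary_mul_conjTranspose {U : Matrix ι ι ℂ} (hU : U ∈ unitaryGroup ι ℂ) :
    U * Uᴴ = 1 := mem_unitaryGroup_iff.1 hU

lemma unitary_conjTranspose_mul {U : Matrix ι ι ℂ} (hU : U ∈ unitaryGroup ι ℂ) :
    Uᴴ * U = 1 := mem_unitaryGroup_iff'.1 hU

lemma conjTranspose_mem_unitaryGroup {U : Matrix ι ι ℂ} (hU : U ∈ unitaryGroup ι ℂ) :
    Uᴴ ∈ unitaryGroup ι ℂ := by
  rw [mem_unitaryGroup_iff, star_eq_conjTranspose, conjTranspose_conjTranspose]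
  exact unitary_conjTranspose_mul hU

lemma Matrix.IsHermitian.exists_eq_conjDiag {f : Matrix ι ι ℂ} (hf : f.IsHermitian) :
    ∃ U ∈ unitaryGroup ι ℂ, f = conjDiag U hf.eigenvalues := by
  refine ⟨hf.eigenvectorUnitary, hf.eigenvectorUnitary.2, ?_⟩
  conv_lhs => rw [hf.spectral_theorem, Unitary.conjStarAlgAut_apply]
  rfl

lemma conjDiag_isHermitian (U : Matrix ι ι ℂ) (x : ι → ℝ) : (conjDiag U x).IsHermitian := by
  have h : (diagonal fun i => (x i : ℂ)).IsHermitian := by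
    rw [Matrix.IsHermitian, diagonal_conjTranspose]
    congr 1
    ext i
    simp
  exact isHermitian_mul_mul_conjTranspose U h

lemma conjDiag_mul {U : Matrix ι ι ℂ} (hU : U ∈ unitaryGroup ι ℂ) (x y : ι → ℝ) :
    conjDiag U x * conjDiag U y = conjDiag U (fun i => x i * y i) := by
  have h : conjDiag U x * conjDiag U y =
      U * diagonal (fun i => (x i : ℂ)) * (Uᴴ * U) * diagonal (fun i => (y i : ℂ)) * Uᴴ := by
    simp only [conjDiag, Matrix.mul_assoc]
  rw [h, unitary_conjTranspose_mul hU, Matrix.mul_one, Matrix.mul_assoc U, diagonal_mul_diagonal]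
  simp [conjDiag]

lemma conjDiag_add (U : Matrix ι ι ℂ) (x y : ι → ℝ) :
    conjDiag U (fun i => x i + y i) = conjDiag U x + conjDiag U y := by
  simp only [conjDiag, ← Matrix.add_mul, ← Matrix.mul_add, diagonal_add]
  simp

lemma conjDiag_const {U : Matrix ι ι ℂ} (hU : U ∈ unitaryGroup ι ℂ) (c : ℝ) :
    conjDiag U (fun _ => c) = (c : ℂ) • 1 := by
  have h : (diagonal fun _ : ι => (c : ℂ)) = (c : ℂ) • (1 : Matrix ι ι ℂ) := by
    rw [smul_one_eq_diagonal]
  simp [conjDiag, h, unitary_mul_conjTranspose hU]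

lemma conjDiag_smul (U : Matrix ι ι ℂ) (c : ℝ) (x : ι → ℝ) :
    conjDiag U (fun i => c * x i) = (c : ℂ) • conjDiag U x := by
  have h : (diagonal fun i : ι => ((c * x i : ℝ) : ℂ)) =
      (c : ℂ) • (diagonal fun i => (x i : ℂ)) := by
    rw [← diagonal_smul]; congr 1; ext i; simp
  rw [conjDiag, conjDiag, h, Matrix.mul_smul, Matrix.smul_mul]

lemma conjDiag_conj (P U : Matrix ι ι ℂ) (x : ι → ℝ) :
    P * conjDiag U x * Pᴴ = conjDiag (P * U) x := by
  simp only [conjDiag, conjTranspose_mul, Matrix.mul_assoc]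

lemma rtr_conjDiag {U : Matrix ι ι ℂ} (hU : U ∈ unitaryGroup ι ℂ) (x : ι → ℝ) :
    rtr (conjDiag U x) = ∑ i, x i := by
  rw [rtr, conjDiag, Matrix.trace_mul_comm, ← Matrix.mul_assoc, unitary_conjTranspose_mul hU,
    Matrix.one_mul, trace_diagonal]
  simp

lemma sum_normSq_row {W : Matrix ι ι ℂ} (hW : W ∈ unitaryGroup ι ℂ) (i : ι) :
    ∑ j, Complex.normSq (W i j) = 1 := by
  have h := congrFun (congrFun (unitary_mul_conjTranspose hW) i) i
  rw [Matrix.mul_apply, one_apply_eq] at h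
  simp only [conjTranspose_apply, Complex.star_def, Complex.mul_conj] at h
  exact_mod_cast h

lemma sum_overlap_right {U V : Matrix ι ι ℂ} (hU : U ∈ unitaryGroup ι ℂ)
    (hV : V ∈ unitaryGroup ι ℂ) (i : ι) : ∑ j, overlap U V i j = 1 :=
  sum_normSq_row (mul_mem (conjTranspose_mem_unitaryGroup hU) hV) i

lemma sum_overlap_left {U V : Matrix ι ι ℂ} (hU : U ∈ unitaryGroup ι ℂ)
    (hV : V ∈ unitaryGroup ι ℂ) (j : ι) : ∑ i, overlap U V i j = 1 := by
  simp_rw [overlap_comm U V]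
  exact sum_overlap_right hV hU j

lemma rtr_diagonal_mul (x y : ι → ℝ) (W : Matrix ι ι ℂ) :
    rtr (diagonal (fun i => (x i : ℂ)) * W * diagonal (fun i => (y i : ℂ)) * Wᴴ) =
      ∑ i, ∑ j, Complex.normSq (W i j) * (x i * y j) := by
  simp only [rtr, trace, diag_apply, Matrix.mul_apply (M := _ * _ * _), Complex.re_sum]
  refine Finset.sum_congr rfl fun i _ => Finset.sum_congr rfl fun j _ => ?_
  rw [mul_diagonal, diagonal_mul, conjTranspose_apply, Complex.star_def]
  have : (x i : ℂ) * W i j * y j * (starRingEnd ℂ) (W i j) =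
      ((Complex.normSq (W i j) * (x i * y j) : ℝ) : ℂ) := by
    push_cast
    rw [Complex.normSq_eq_conj_mul_self]
    ring
  rw [this, Complex.ofReal_re]

lemma rtr_conjDiag_mul_conjDiag (U V : Matrix ι ι ℂ) (x y : ι → ℝ) :
    rtr (conjDiag U x * conjDiag V y) = ∑ i, ∑ j, overlap U V i j * (x i * y j) := by
  have h : rtr (conjDiag U x * conjDiag V y) = rtr (diagonal (fun i => (x i : ℂ)) * (Uᴴ * V) *
      diagonal (fun i => (y i : ℂ)) * (Uᴴ * V)ᴴ) := by
    rw [conjTranspose_mul, conjTranspose_conjTranspose]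
    simp only [conjDiag, Matrix.mul_assoc]
    rw [rtr_mul_comm]
    simp only [Matrix.mul_assoc]
  rw [h, rtr_diagonal_mul]
  rfl

lemma sum_sum_overlap_left {U V : Matrix ι ι ℂ} (hU : U ∈ unitaryGroup ι ℂ)
    (hV : V ∈ unitaryGroup ι ℂ) (x : ι → ℝ) :
    ∑ i, ∑ j, overlap U V i j * x i = ∑ i, x i := by
  simp_rw [← Finset.sum_mul, sum_overlap_right hU hV, one_mul]

lemma sum_sum_overlap_right {U V : Matrix ι ι ℂ} (hU : U ∈ unitaryGroup ι ℂ)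
    (hV : V ∈ unitaryGroup ι ℂ) (y : ι → ℝ) :
    ∑ i, ∑ j, overlap U V i j * y j = ∑ j, y j := by
  rw [Finset.sum_comm]
  simp_rw [← Finset.sum_mul, sum_overlap_left hU hV, one_mul]

lemma rtr_sub_sq {U V : Matrix ι ι ℂ} (hU : U ∈ unitaryGroup ι ℂ)
    (hV : V ∈ unitaryGroup ι ℂ) (x y : ι → ℝ) :
    rtr ((conjDiag V y - conjDiag U x) * (conjDiag V y - conjDiag U x)) =
      ∑ i, ∑ j, overlap U V i j * (y j - x i) ^ 2 := by
  have h1 : ∑ i, ∑ j, overlap U V i j * (y j - x i) ^ 2 =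
      ∑ i, ∑ j, overlap U V i j * (y j * y j) + ∑ i, ∑ j, overlap U V i j * (x i * x i)
        - 2 * ∑ i, ∑ j, overlap U V i j * (x i * y j) := by
    simp only [Finset.mul_sum, ← Finset.sum_add_distrib, ← Finset.sum_sub_distrib]
    refine Finset.sum_congr rfl fun i _ => Finset.sum_congr rfl fun j _ => ?_
    ring
  rw [h1, sum_sum_overlap_right hU hV (fun j => y j * y j),
    sum_sum_overlap_left hU hV (fun j => x j * x j), ← rtr_conjDiag_mul_conjDiag,
    ← rtr_conjDiag hV, ← rtr_conjDiag hU, ← conjDiag_mul hV, ← conjDiag_mul hU,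
    Matrix.sub_mul, Matrix.mul_sub, Matrix.mul_sub, rtr_sub, rtr_sub, rtr_sub,
    rtr_mul_comm (conjDiag V y) (conjDiag U x)]
  ring

lemma overlap_eq_zero_or {U V : Matrix ι ι ℂ} (hU : U ∈ unitaryGroup ι ℂ)
    (hV : V ∈ unitaryGroup ι ℂ) {x y : ι → ℝ} (h : conjDiag U x = conjDiag V y) (i j : ι) :
    overlap U V i j = 0 ∨ x i = y j := by
  have h0 := rtr_sub_sq hU hV x y
  rw [← h, sub_self, Matrix.zero_mul] at h0
  have hz : rtr (0 : Matrix ι ι ℂ) = 0 := by simp [rtr]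
  rw [hz, eq_comm, Finset.sum_eq_zero_iff_of_nonneg fun i _ => Finset.sum_nonneg fun j _ =>
    mul_nonneg (overlap_nonneg _ _ _ _) (sq_nonneg _)] at h0
  have h1 := h0 i (Finset.mem_univ _)
  rw [Finset.sum_eq_zero_iff_of_nonneg fun j _ =>
    mul_nonneg (overlap_nonneg _ _ _ _) (sq_nonneg _)] at h1
  rcases mul_eq_zero.1 (h1 j (Finset.mem_univ _)) with h2 | h2
  · exact Or.inl h2
  · right
    have := pow_eq_zero_iff (two_ne_zero) |>.1 h2
    linarith

lemma sum_eq_of_conjDiag_eq {U V : Matrix ι ι ℂ} (hU : U ∈ unitaryGroup ι ℂ)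
    (hV : V ∈ unitaryGroup ι ℂ) {x y : ι → ℝ} (h : conjDiag U x = conjDiag V y) (F : ℝ → ℝ) :
    ∑ i, F (x i) = ∑ i, F (y i) := by
  rw [← sum_sum_overlap_left hU hV fun i => F (x i),
    ← sum_sum_overlap_right hU hV fun j => F (y j)]
  refine Finset.sum_congr rfl fun i _ => Finset.sum_congr rfl fun j _ => ?_
  rcases overlap_eq_zero_or hU hV h i j with h | h <;> simp [h]

/-- The trace `Tr F(f)` of a function of a Hermitian matrix (`0` on non-Hermitian matrices). -/
noncomputable def specSum (F : ℝ → ℝ) (f : Matrix ι ι ℂ) : ℝ :=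
  if hf : f.IsHermitian then ∑ i, F (hf.eigenvalues i) else 0

lemma specSum_conjDiag {U : Matrix ι ι ℂ} (hU : U ∈ unitaryGroup ι ℂ) (x : ι → ℝ) (F : ℝ → ℝ) :
    specSum F (conjDiag U x) = ∑ i, F (x i) := by
  have hf := conjDiag_isHermitian U x
  obtain ⟨V, hV, h⟩ := hf.exists_eq_conjDiag
  rw [specSum, dif_pos hf]
  exact (sum_eq_of_conjDiag_eq hU hV h F).symm

lemma specSum_sq {f : Matrix ι ι ℂ} (hf : f.IsHermitian) :
    specSum (fun x => x ^ 2) f = rtr (f * f) := by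
  obtain ⟨U, hU, h⟩ := hf.exists_eq_conjDiag
  rw [h, specSum_conjDiag hU, conjDiag_mul hU, rtr_conjDiag hU]
  simp_rw [sq]

lemma rtr_mul_self_nonneg {f : Matrix ι ι ℂ} (hf : f.IsHermitian) : 0 ≤ rtr (f * f) := by
  rw [← specSum_sq hf, specSum, dif_pos hf]
  positivity

lemma conjDiag_posSemidef (U : Matrix ι ι ℂ) {x : ι → ℝ} (hx : ∀ i, 0 ≤ x i) :
    (conjDiag U x).PosSemidef := by
  refine PosSemidef.mul_mul_conjTranspose_same ?_ U
  refine PosSemidef.diagonal fun i => ?_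
  simpa using hx i

lemma nonneg_of_conjDiag_posSemidef {U : Matrix ι ι ℂ} (hU : U ∈ unitaryGroup ι ℂ) {x : ι → ℝ}
    (h : (conjDiag U x).PosSemidef) (i : ι) : 0 ≤ x i := by
  have h1 := h.conjTranspose_mul_mul_same U
  have h2 : Uᴴ * conjDiag U x * U = diagonal fun i => (x i : ℂ) := by
    have : Uᴴ * conjDiag U x * U = (Uᴴ * U) * diagonal (fun i => (x i : ℂ)) * (Uᴴ * U) := by
      simp only [conjDiag, Matrix.mul_assoc]
    rw [this, unitary_conjTranspose_mul hU, Matrix.one_mul, Matrix.mul_one]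
  rw [h2, posSemidef_diagonal_iff] at h1
  exact_mod_cast h1 i

lemma conjDiag_sub_const {U : Matrix ι ι ℂ} (hU : U ∈ unitaryGroup ι ℂ) (x : ι → ℝ) (c : ℝ) :
    conjDiag U x - (c : ℂ) • 1 = conjDiag U (fun i => x i - c) := by
  have h := conjDiag_add U (fun i => x i - c) (fun _ => c)
  simp only [sub_add_cancel] at h
  rw [conjDiag_const hU] at h
  exact sub_eq_of_eq_add h

lemma le_of_conjDiag_sub_posSemidef {U : Matrix ι ι ℂ} (hU : U ∈ unitaryGroup ι ℂ) {x : ι → ℝ}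
    {c : ℝ} (h : (conjDiag U x - (c : ℂ) • 1).PosSemidef) (i : ι) : c ≤ x i := by
  rw [conjDiag_sub_const hU] at h
  exact sub_nonneg.1 (nonneg_of_conjDiag_posSemidef hU h i)

lemma le_of_sub_conjDiag_posSemidef {U : Matrix ι ι ℂ} (hU : U ∈ unitaryGroup ι ℂ) {x : ι → ℝ}
    {c : ℝ} (h : ((c : ℂ) • 1 - conjDiag U x).PosSemidef) (i : ι) : x i ≤ c := by
  have h1 : (c : ℂ) • 1 - conjDiag U x = conjDiag U (fun i => c - x i) := by
    have h2 := conjDiag_smul U (-1) (fun i => x i - c)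
    rw [← conjDiag_sub_const hU] at h2
    simpa using h2.symm
  rw [h1] at h
  exact sub_nonneg.1 (nonneg_of_conjDiag_posSemidef hU h i)

end Spectral

section Calculus

lemma exists_taylor_bound {F : ℝ → ℝ → ℝ} {J : Set ℝ} (hJ : IsOpen J) {l r δ R : ℝ} (hδ : 0 < δ)
    (hlr : Set.Icc l r ⊆ J)
    (hF : ContDiffOn ℝ 2 (fun p : ℝ × ℝ => F p.1 p.2) (J ×ˢ Set.Ioi 0)) :
    ∃ C : ℝ, ∀ a ∈ Set.Icc l r, ∀ x ∈ Set.Icc δ R, ∀ Ft Fx : ℝ,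
      HasDerivAt (fun t => F t x) Ft a → HasDerivAt (F a) Fx x →
      ∀ t ∈ Set.Icc l r, ∀ y ∈ Set.Icc δ R,
        |F t y - F a x - Fx * (y - x) - Ft * (t - a)| ≤ C * ((y - x) ^ 2 + (t - a) ^ 2) := by
  set G : ℝ × ℝ → ℝ := fun p => F p.1 p.2 with hG
  have hopen : IsOpen (J ×ˢ Set.Ioi (0 : ℝ)) := hJ.prod isOpen_Ioi
  have hsub : Set.Icc l r ×ˢ Set.Icc δ R ⊆ J ×ˢ Set.Ioi (0 : ℝ) :=
    Set.prod_mono hlr fun x hx => hδ.trans_le hx.1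
  have hd : ∀ p ∈ J ×ˢ Set.Ioi (0 : ℝ), HasFDerivAt G (fderiv ℝ G p) p := fun p hp =>
    ((hF.contDiffAt (hopen.mem_nhds hp)).differentiableAt (by norm_num)).hasFDerivAt
  have hconv : Convex ℝ (Set.Icc l r ×ˢ Set.Icc δ R) := (convex_Icc l r).prod (convex_Icc δ R)
  have hc1 : ContDiffOn ℝ 1 (fderiv ℝ G) (Set.Icc l r ×ˢ Set.Icc δ R) :=
    (hF.fderiv_of_isOpen hopen (by norm_num)).mono hsub
  obtain ⟨C, hC⟩ := hc1.exists_lipschitzOnWith (by norm_num) hconv (isCompact_Icc.prod isCompact_Icc)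
  refine ⟨C, fun a ha x hx Ft Fx hFt hFx t ht y hy => ?_⟩
  have hp : ((a, x) : ℝ × ℝ) ∈ Set.Icc l r ×ˢ Set.Icc δ R := ⟨ha, hx⟩
  have hp' : ((t, y) : ℝ × ℝ) ∈ Set.Icc l r ×ˢ Set.Icc δ R := ⟨ht, hy⟩
  have h1 : fderiv ℝ G (a, x) (1, 0) = Ft := by
    have h := (hd _ (hsub hp)).comp_hasDerivAt a ((hasDerivAt_id a).prodMk (hasDerivAt_const a x))
    exact h.unique hFt
  have h2 : fderiv ℝ G (a, x) (0, 1) = Fx := by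
    have h := (hd _ (hsub hp)).comp_hasDerivAt x ((hasDerivAt_const x a).prodMk (hasDerivAt_id x))
    exact h.unique hFx
  have h3 : fderiv ℝ G (a, x) ((t, y) - (a, x)) = Fx * (y - x) + Ft * (t - a) := by
    have : ((t, y) - (a, x) : ℝ × ℝ) = (t - a) • (1, 0) + (y - x) • (0, 1) := by simp
    rw [this, map_add, map_smul, map_smul, h1, h2]
    simp only [smul_eq_mul]; ring
  have hseg : segment ℝ ((a, x) : ℝ × ℝ) (t, y) ⊆ Set.Icc l r ×ˢ Set.Icc δ R :=
    hconv.segment_subset hp hp'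
  have h4 := (convex_segment ((a, x) : ℝ × ℝ) (t, y)).norm_image_sub_le_of_norm_hasFDerivWithin_le'
    (f := G) (f' := fderiv ℝ G) (C := C * ‖((t, y) - (a, x) : ℝ × ℝ)‖) (φ := fderiv ℝ G (a, x))
    (fun z hz => (hd z (hsub (hseg hz))).hasFDerivWithinAt)
    (fun z hz => by
      refine (hC.norm_sub_le (hseg hz) hp).trans ?_
      gcongr
      exact norm_sub_le_of_mem_segment hz)
    (left_mem_segment _ _ _) (right_mem_segment _ _ _)
  rw [h3, Real.norm_eq_abs] at h4
  have h5 : ‖((t, y) - (a, x) : ℝ × ℝ)‖ * ‖((t, y) - (a, x) : ℝ × ℝ)‖ ≤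
      (y - x) ^ 2 + (t - a) ^ 2 := by
    rw [Prod.norm_def]
    simp only [Prod.fst_sub, Prod.snd_sub, Real.norm_eq_abs]
    rcases max_cases |t - a| |y - x| with h | h <;> rw [h.1, abs_mul_abs_self] <;>
      nlinarith [sq_nonneg (t - a), sq_nonneg (y - x)]
  calc |F t y - F a x - Fx * (y - x) - Ft * (t - a)|
      = |G (t, y) - G (a, x) - (Fx * (y - x) + Ft * (t - a))| := by simp only [hG]; ring_nf
    _ ≤ C * (‖((t, y) - (a, x) : ℝ × ℝ)‖ * ‖((t, y) - (a, x) : ℝ × ℝ)‖) := by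
        rw [← mul_assoc]; exact h4
    _ ≤ _ := by gcongr

variable {ι : Type*} [Fintype ι]

lemma hasDerivWithinAt_rtr_mul {A B : ℝ → Matrix ι ι ℂ} {A' B' : Matrix ι ι ℂ} {s : Set ℝ} {a : ℝ}
    (hA : ∀ i j, HasDerivWithinAt (fun t => A t i j) (A' i j) s a)
    (hB : ∀ i j, HasDerivWithinAt (fun t => B t i j) (B' i j) s a) :
    HasDerivWithinAt (fun t => rtr (A t * B t)) (rtr (A' * B a) + rtr (A a * B')) s a := by
  have h : HasDerivWithinAt (fun t => ∑ i, ∑ j, A t i j * B t j i)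
      (∑ i, ∑ j, (A' i j * B a j i + A a i j * B' j i)) s a :=
    HasDerivWithinAt.fun_sum fun i _ => HasDerivWithinAt.fun_sum fun j _ => (hA i j).mul (hB j i)
  have h2 := (Complex.reCLM.hasFDerivAt.comp_hasDerivWithinAt a h)
  refine (h2.congr_deriv ?_).congr_of_eventuallyEq (Filter.Eventually.of_forall fun t => ?_) ?_
  · rw [← rtr_add]
    simp [rtr, trace, Matrix.mul_apply, Finset.sum_add_distrib]
  · simp [rtr, trace, Matrix.mul_apply]
  · simp [rtr, trace, Matrix.mul_apply]

variable [DecidableEq ι]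

/-- Differentiation of the trace of a function of a Hermitian matrix along a curve, where the
function is allowed to depend on the parameter as well. -/
lemma hasDerivWithinAt_specSum {F : ℝ → ℝ → ℝ} {J : Set ℝ} (hJ : IsOpen J) {l r δ R : ℝ}
    (hδ : 0 < δ) (hlr : Set.Icc l r ⊆ J)
    (hF : ContDiffOn ℝ 2 (fun p : ℝ × ℝ => F p.1 p.2) (J ×ˢ Set.Ioi 0))
    {X : ℝ → Matrix ι ι ℂ} (hX : ∀ t ∈ Set.Icc l r, (X t).IsHermitian)
    (hXδ : ∀ t ∈ Set.Icc l r, (X t - (δ : ℂ) • 1).PosSemidef)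
    (hXR : ∀ t ∈ Set.Icc l r, ((R : ℂ) • 1 - X t).PosSemidef)
    {a : ℝ} (ha : a ∈ Set.Icc l r) {X' : Matrix ι ι ℂ}
    (hX' : ∀ i j, HasDerivWithinAt (fun t => X t i j) (X' i j) (Set.Icc l r) a)
    {U : Matrix ι ι ℂ} (hU : U ∈ unitaryGroup ι ℂ) {x : ι → ℝ} (hXa : X a = conjDiag U x)
    {Ft Fx : ι → ℝ} (hFt : ∀ i, HasDerivAt (fun t => F t (x i)) (Ft i) a)
    (hFx : ∀ i, HasDerivAt (F a) (Fx i) (x i)) :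
    HasDerivWithinAt (fun t => specSum (F t) (X t))
      (rtr (conjDiag U Fx * X') + ∑ i, Ft i) (Set.Icc l r) a := by
  obtain ⟨C, hC⟩ := exists_taylor_bound (R := R) hJ hδ hlr hF
  have hxmem : ∀ i, x i ∈ Set.Icc δ R := fun i =>
    ⟨le_of_conjDiag_sub_posSemidef hU (hXa ▸ hXδ a ha) i,
      le_of_sub_conjDiag_posSemidef hU (hXa ▸ hXR a ha) i⟩
  set q : ℝ → ℝ := fun t => rtr ((X t - X a) * (X t - X a)) + Fintype.card ι * (t - a) ^ 2 with hq
  have hq' : HasDerivWithinAt q 0 (Set.Icc l r) a := by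
    have h0 : ∀ i j, HasDerivWithinAt (fun t => (X t - X a) i j) (X' i j) (Set.Icc l r) a :=
      fun i j => (hX' i j).sub_const (X a i j)
    have h1 := hasDerivWithinAt_rtr_mul h0 h0
    have h2 : HasDerivWithinAt (fun t : ℝ => Fintype.card ι * (t - a) ^ 2)
        (Fintype.card ι * (2 * (a - a) ^ 1 * 1)) (Set.Icc l r) a :=
      (((hasDerivAt_id a).sub_const a).pow 2 |>.const_mul _).hasDerivWithinAt
    exact (h1.add h2).congr_deriv (by simp [rtr])
  set m : ℝ → ℝ := fun t => rtr (conjDiag U Fx * X t) + (∑ i, Ft i) * t with hm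
  have hm' : HasDerivWithinAt m (rtr (conjDiag U Fx * X') + ∑ i, Ft i) (Set.Icc l r) a := by
    have h1 := hasDerivWithinAt_rtr_mul (A := fun _ => conjDiag U Fx) (A' := 0)
      (fun i j => hasDerivWithinAt_const _ _ _) hX'
    have h2 : HasDerivWithinAt (fun t : ℝ => (∑ i, Ft i) * t) ((∑ i, Ft i) * 1) (Set.Icc l r) a :=
      ((hasDerivAt_id a).const_mul _).hasDerivWithinAt
    exact (h1.add h2).congr_deriv (by simp [rtr])
  have hbound : ∀ t ∈ Set.Icc l r,
      |specSum (F t) (X t) - m t - (specSum (F a) (X a) - m a)| ≤ C * q t := by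
    intro t ht
    obtain ⟨V, hV, hXt⟩ := (hX t ht).exists_eq_conjDiag
    set y := (hX t ht).eigenvalues
    have hymem : ∀ j, y j ∈ Set.Icc δ R := fun j =>
      ⟨le_of_conjDiag_sub_posSemidef hV (hXt ▸ hXδ t ht) j,
        le_of_sub_conjDiag_posSemidef hV (hXt ▸ hXR t ht) j⟩
    have e1 : specSum (F t) (X t) - m t - (specSum (F a) (X a) - m a) =
        ∑ i, ∑ j, overlap U V i j *
          (F t (y j) - F a (x i) - Fx i * (y j - x i) - Ft i * (t - a)) := by
      have e2 : ∑ i, ∑ j, overlap U V i j *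
          (F t (y j) - F a (x i) - Fx i * (y j - x i) - Ft i * (t - a)) =
          ∑ i, ∑ j, overlap U V i j * F t (y j) - ∑ i, ∑ j, overlap U V i j * F a (x i)
          - (∑ i, ∑ j, overlap U V i j * (Fx i * y j)
              - ∑ i, ∑ j, overlap U V i j * (Fx i * x i))
          - (∑ i, ∑ j, overlap U V i j * Ft i) * (t - a) := by
        simp only [Finset.sum_mul, ← Finset.sum_sub_distrib]
        refine Finset.sum_congr rfl fun i _ => Finset.sum_congr rfl fun j _ => ?_
        ring
      rw [e2, sum_sum_overlap_right hU hV fun j => F t (y j),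
        sum_sum_overlap_left hU hV fun i => F a (x i),
        sum_sum_overlap_left hU hV fun i => Fx i * x i, sum_sum_overlap_left hU hV,
        ← rtr_conjDiag_mul_conjDiag, ← rtr_conjDiag hU fun i => Fx i * x i, ← conjDiag_mul hU]
      simp only [hm, hXa]
      rw [hXt, specSum_conjDiag hV, specSum_conjDiag hU]
      ring
    rw [e1]
    have e3 : C * q t = ∑ i, ∑ j, overlap U V i j * (C * ((y j - x i) ^ 2 + (t - a) ^ 2)) := by
      have e4 : ∑ i, ∑ j, overlap U V i j * (C * ((y j - x i) ^ 2 + (t - a) ^ 2)) =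
          C * (∑ i, ∑ j, overlap U V i j * (y j - x i) ^ 2
            + ∑ i, ∑ j, overlap U V i j * (t - a) ^ 2) := by
        simp only [Finset.mul_sum, ← Finset.sum_add_distrib]
        refine Finset.sum_congr rfl fun i _ => Finset.sum_congr rfl fun j _ => ?_
        ring
      rw [e4, ← rtr_sub_sq hU hV, sum_sum_overlap_left hU hV fun _ => (t - a) ^ 2, ← hXt, ← hXa]
      simp [hq]
    rw [e3]
    refine (Finset.abs_sum_le_sum_abs _ _).trans (Finset.sum_le_sum fun i _ => ?_)
    refine (Finset.abs_sum_le_sum_abs _ _).trans (Finset.sum_le_sum fun j _ => ?_)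
    rw [abs_mul, abs_of_nonneg (overlap_nonneg _ _ _ _)]
    exact mul_le_mul_of_nonneg_left
      (hC a ha (x i) (hxmem i) (Ft i) (Fx i) (hFt i) (hFx i) t ht (y j) (hymem j))
      (overlap_nonneg _ _ _ _)
  have hrem : HasDerivWithinAt (fun t => specSum (F t) (X t) - m t) 0 (Set.Icc l r) a := by
    rw [hasDerivWithinAt_iff_isLittleO] at hq' ⊢
    have hqa : q a = 0 := by simp [hq, rtr]
    simp only [smul_zero, sub_zero, hqa] at hq' ⊢
    refine Asymptotics.IsBigO.trans_isLittleO ?_ hq'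
    refine Asymptotics.IsBigO.of_bound |C| ?_
    filter_upwards [self_mem_nhdsWithin] with t ht
    rw [Real.norm_eq_abs, Real.norm_eq_abs, ← abs_mul]
    exact (hbound t ht).trans (le_abs_self _)
  refine ((hrem.add hm').congr_deriv (zero_add _)).congr_of_eventuallyEq
    (Filter.Eventually.of_forall fun t => ?_) ?_ <;> simp

end Calculus

section Scalar

/-- The logarithmic-mean inequality `(x - y) / (log x - log y) ≤ (x + y) / 2` in the form of an
upper bound on the divided difference of `x log x`. -/
lemma mul_log_sub_le {x y : ℝ} (hx : 0 < x) (hy : 0 < y) :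
    (x * Real.log x - y * Real.log y) * (x - y) ≤
      (x - y) ^ 2 * (Real.log ((x + y) / 2) + 1) := by
  wlog hxy : y ≤ x generalizing x y
  · have := this hy hx (le_of_not_ge hxy)
    rw [add_comm y x] at this
    nlinarith [this]
  set m := (x + y) / 2 with hm
  have hm0 : 0 < m := by positivity
  have key : ∀ d ∈ Set.Ico 0 m, (m + d) * Real.log (m + d) - (m - d) * Real.log (m - d)
      - 2 * d * (Real.log m + 1) ≤ 0 := by
    have hder : ∀ d ∈ Set.Ico 0 m, HasDerivAt (fun d => (m + d) * Real.log (m + d)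
        - (m - d) * Real.log (m - d) - 2 * d * (Real.log m + 1))
        (Real.log (m + d) + Real.log (m - d) - 2 * Real.log m) d := by
      intro d hd
      have h1 : m + d ≠ 0 := by have := hd.1; positivity
      have h2 : m - d ≠ 0 := (sub_pos.2 hd.2).ne'
      have e1 := (Real.hasDerivAt_mul_log h1).comp d ((hasDerivAt_id d).const_add m)
      have e2 := (Real.hasDerivAt_mul_log h2).comp d ((hasDerivAt_id d).const_sub m)
      have e3 := (((hasDerivAt_id d).const_mul 2).mul_const (Real.log m + 1))
      exact ((e1.sub e2).sub e3).congr_deriv (by ring)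
    have hanti : AntitoneOn (fun d => (m + d) * Real.log (m + d)
        - (m - d) * Real.log (m - d) - 2 * d * (Real.log m + 1)) (Set.Ico 0 m) := by
      refine antitoneOn_of_hasDerivWithinAt_nonpos (convex_Ico 0 m)
        (fun d hd => (hder d hd).continuousAt.continuousWithinAt)
        (fun d hd => (hder d (interior_subset hd)).hasDerivWithinAt) fun d hd => ?_
      have hd' := interior_subset hd
      have h1 : 0 < m + d := by have := hd'.1; positivity
      have h2 : 0 < m - d := sub_pos.2 hd'.2
      have : Real.log (m + d) + Real.log (m - d) ≤ 2 * Real.log m := by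
        rw [← Real.log_mul h1.ne' h2.ne', ← Real.log_rpow hm0]
        refine Real.log_le_log (by positivity) ?_
        norm_num
        nlinarith [sq_nonneg d]
      linarith
    intro d hd
    have := hanti ⟨le_rfl, hm0⟩ hd hd.1
    simpa using this
  have h := key ((x - y) / 2) ⟨by linarith, by rw [hm]; linarith⟩
  have h1 : m + (x - y) / 2 = x := by rw [hm]; ring
  have h2 : m - (x - y) / 2 = y := by rw [hm]; ring
  rw [h1, h2] at h
  have h3 : 0 ≤ x - y := by linarith
  nlinarith [mul_nonneg h3 (sub_nonneg.2 h)]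

lemma sum_sq_mul_log_le {ι : Type*} [Fintype ι] {β ξ : ι → ℝ} (hξ : ∀ k, 0 < ξ k) {N : ℝ}
    (hN0 : 0 < N) (hN : ∑ k, ξ k ^ 2 ≤ N) :
    2 * ∑ k, β k ^ 2 * Real.log (ξ k) ≤
      ∑ k, β k ^ 2 * Real.log (β k ^ 2) + (∑ k, β k ^ 2) * Real.log (N / ∑ k, β k ^ 2) := by
  set S := ∑ k, β k ^ 2 with hS
  have hS0 : 0 ≤ S := Finset.sum_nonneg fun k _ => sq_nonneg _
  rcases hS0.eq_or_lt with h0 | h0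
  · have hz : ∀ k, β k ^ 2 = 0 := fun k =>
      (Finset.sum_eq_zero_iff_of_nonneg fun k _ => sq_nonneg (β k)).1 h0.symm k (Finset.mem_univ _)
    simp [hz, ← h0]
  have key : ∀ k, 2 * (β k ^ 2 * Real.log (ξ k)) ≤ β k ^ 2 * Real.log (β k ^ 2)
      + β k ^ 2 * Real.log (N / S) + (ξ k ^ 2 * (S / N) - β k ^ 2) := by
    intro k
    rcases eq_or_ne (β k) 0 with hb | hb
    · simp only [hb]
      have : 0 ≤ ξ k ^ 2 * (S / N) := by positivity
      simpa using this
    have hb2 : 0 < β k ^ 2 := by positivity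
    have hx2 : 0 < ξ k ^ 2 := pow_pos (hξ k) 2
    have h1 := Real.log_le_sub_one_of_pos (x := ξ k ^ 2 * (S / N) / β k ^ 2)
      (by positivity)
    rw [Real.log_div (by positivity) hb2.ne', Real.log_mul hx2.ne' (by positivity),
      ← inv_div, Real.log_inv, Real.log_pow] at h1
    have h2 := mul_le_mul_of_nonneg_left h1 hb2.le
    have h3 : β k ^ 2 * (ξ k ^ 2 * (N / S)⁻¹ / β k ^ 2 - 1) = ξ k ^ 2 * (S / N) - β k ^ 2 := by
      field_simp
    rw [h3] at h2
    push_cast at h2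
    nlinarith [h2]
  have hsum := Finset.sum_le_sum fun k (_ : k ∈ Finset.univ) => key k
  rw [← Finset.mul_sum, Finset.sum_add_distrib, Finset.sum_add_distrib, Finset.sum_sub_distrib,
    ← Finset.sum_mul, ← Finset.sum_mul, ← hS] at hsum
  have h4 : (∑ k, ξ k ^ 2) * (S / N) ≤ S := by
    calc _ ≤ N * (S / N) := by gcongr
      _ = S := by field_simp
  linarith

end Scalar

section Entropy

variable {ι : Type*} [Fintype ι]

lemma rtr_mul_conjTranspose (B Z : Matrix ι ι ℂ) :
    rtr (B * Zᴴ) = ∑ i, ∑ j, (B i j * star (Z i j)).re := by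
  simp [rtr, trace, Matrix.mul_apply]

variable [DecidableEq ι]

/-- A Hermitian unitary matrix. -/
def IsReflection (P : Matrix ι ι ℂ) : Prop := P.IsHermitian ∧ P * P = 1

lemma IsReflection.mem_unitaryGroup {P : Matrix ι ι ℂ} (hP : IsReflection P) :
    P ∈ unitaryGroup ι ℂ := by
  rw [mem_unitaryGroup_iff, star_eq_conjTranspose, hP.1]
  exact hP.2

lemma IsReflection.conj_conjDiag {P : Matrix ι ι ℂ} (hP : IsReflection P) (U : Matrix ι ι ℂ)
    (x : ι → ℝ) : P * conjDiag U x * P = conjDiag (P * U) x := by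
  conv_lhs => rw [← hP.1.eq]
  rw [← conjDiag_conj, hP.1.eq]

lemma IsReflection.overlap_comm {P : Matrix ι ι ℂ} (hP : IsReflection P) (U : Matrix ι ι ℂ)
    (i j : ι) : overlap U (P * U) i j = overlap U (P * U) j i := by
  rw [_root_.overlap_comm, overlap, overlap, conjTranspose_mul, hP.1.eq, Matrix.mul_assoc]

/-- Spectral expression of the Dirichlet form of a reflection. -/
lemma rtr_mul_sub_conj {P : Matrix ι ι ℂ} (hP : IsReflection P) {U : Matrix ι ι ℂ}
    (hU : U ∈ unitaryGroup ι ℂ) (φ ψ : ι → ℝ) :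
    rtr (conjDiag U φ * (conjDiag U ψ - P * conjDiag U ψ * P)) =
      1 / 2 * ∑ i, ∑ j, overlap U (P * U) i j * ((φ i - φ j) * (ψ i - ψ j)) := by
  have hPU := mul_mem hP.mem_unitaryGroup hU
  have h1 : ∑ i, ∑ j, overlap U (P * U) i j * ((φ i - φ j) * (ψ i - ψ j)) =
      ∑ i, ∑ j, overlap U (P * U) i j * (φ i * ψ i) + ∑ i, ∑ j, overlap U (P * U) i j * (φ j * ψ j)
      - ∑ i, ∑ j, overlap U (P * U) i j * (φ i * ψ j)
      - ∑ i, ∑ j, overlap U (P * U) i j * (φ j * ψ i) := by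
    simp only [← Finset.sum_add_distrib, ← Finset.sum_sub_distrib]
    refine Finset.sum_congr rfl fun i _ => Finset.sum_congr rfl fun j _ => ?_
    ring
  have h2 : ∑ i, ∑ j, overlap U (P * U) i j * (φ j * ψ i) =
      ∑ i, ∑ j, overlap U (P * U) i j * (φ i * ψ j) := by
    rw [Finset.sum_comm]
    simp_rw [hP.overlap_comm U]
  rw [h1, h2, sum_sum_overlap_left hU hPU fun i => φ i * ψ i,
    sum_sum_overlap_right hU hPU fun i => φ i * ψ i, ← rtr_conjDiag_mul_conjDiag,
    Matrix.mul_sub, rtr_sub, conjDiag_mul hU, rtr_conjDiag hU, hP.conj_conjDiag]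
  ring

lemma sum_sq_div_le {U V W : Matrix ι ι ℂ} (hU : U ∈ unitaryGroup ι ℂ) (hV : V ∈ unitaryGroup ι ℂ)
    (hW : W ∈ unitaryGroup ι ℂ) {x y β ξ : ι → ℝ} (hx : ∀ i, 0 < x i) (hy : ∀ i, 0 < y i)
    (hξ : ∀ k, 0 < ξ k)
    (hξeq : ∀ z : ι → ℝ, rtr ((conjDiag U x + conjDiag V y) * conjDiag W z) = 2 * ∑ k, ξ k * z k)
    {u : ℝ} (hu : 0 ≤ u) :
    ∑ k, β k ^ 2 / (ξ k + u) ≤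
      ∑ i, ∑ j, Complex.normSq ((Uᴴ * conjDiag W β * V) i j) / ((x i + y j) / 2 + u) := by
  set ζ : ι → ℝ := fun k => β k / (ξ k + u) with hζ
  set B := Uᴴ * conjDiag W β * V with hB
  set Z := Uᴴ * conjDiag W ζ * V with hZ
  have hZh : Zᴴ = Vᴴ * conjDiag W ζ * U := by
    rw [hZ, conjTranspose_mul, conjTranspose_mul, conjTranspose_conjTranspose,
      (conjDiag_isHermitian W ζ).eq, Matrix.mul_assoc]
  have pointwise : ∀ i j, 2 * (B i j * star (Z i j)).re
      - ((x i + y j) / 2 + u) * Complex.normSq (Z i j) ≤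
      Complex.normSq (B i j) / ((x i + y j) / 2 + u) := by
    intro i j
    have hm : 0 < (x i + y j) / 2 + u := by have := hx i; have := hy j; positivity
    rw [le_div_iff₀ hm]
    simp only [Complex.normSq_apply, Complex.star_def, Complex.mul_re, Complex.conj_re,
      Complex.conj_im]
    set m := (x i + y j) / 2 + u
    nlinarith [sq_nonneg ((B i j).re - m * (Z i j).re), sq_nonneg ((B i j).im - m * (Z i j).im)]
  refine le_trans ?_ (Finset.sum_le_sum fun i _ => Finset.sum_le_sum fun j _ => pointwise i j)
  have hone : (diagonal fun _ : ι => ((1 : ℝ) : ℂ)) = 1 := by simp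
  have e1 := rtr_diagonal_mul x (fun _ => 1) Z
  have e2 := rtr_diagonal_mul (fun _ => 1) y Z
  have e3 := rtr_diagonal_mul (fun _ => 1) (fun _ => 1) Z
  rw [hone] at e1 e2 e3
  have hx' : conjDiag U x = U * diagonal (fun i => (x i : ℂ)) * Uᴴ := rfl
  have hy' : conjDiag V y = V * diagonal (fun i => (y i : ℂ)) * Vᴴ := rfl
  have f1 : rtr (diagonal (fun i => (x i : ℂ)) * Z * 1 * Zᴴ) =
      rtr (conjDiag U x * conjDiag W (fun k => ζ k * ζ k)) := by
    rw [hZh, ← conjDiag_mul hW, hZ, hx']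
    have : diagonal (fun i => (x i : ℂ)) * (Uᴴ * conjDiag W ζ * V) * 1 * (Vᴴ * conjDiag W ζ * U) =
        (diagonal (fun i => (x i : ℂ)) * Uᴴ * conjDiag W ζ * (V * Vᴴ) * conjDiag W ζ) * U := by
      simp only [Matrix.mul_assoc, Matrix.one_mul]
    rw [this, rtr_mul_comm, unitary_mul_conjTranspose hV]
    simp only [Matrix.mul_assoc, Matrix.one_mul]
  have f2 : rtr (1 * Z * diagonal (fun i => (y i : ℂ)) * Zᴴ) =
      rtr (conjDiag V y * conjDiag W (fun k => ζ k * ζ k)) := by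
    rw [hZh, ← conjDiag_mul hW, hZ, rtr_mul_comm (conjDiag V y), hy']
    have : 1 * (Uᴴ * conjDiag W ζ * V) * diagonal (fun i => (y i : ℂ)) * (Vᴴ * conjDiag W ζ * U) =
        Uᴴ * (conjDiag W ζ * (V * diagonal (fun i => (y i : ℂ)) * Vᴴ) * conjDiag W ζ * U) := by
      simp only [Matrix.mul_assoc, Matrix.one_mul]
    rw [this, rtr_mul_comm, Matrix.mul_assoc _ U, unitary_mul_conjTranspose hU, Matrix.mul_one,
      rtr_mul_comm]
    simp only [Matrix.mul_assoc]
  have f3 : rtr (1 * Z * 1 * Zᴴ) = ∑ k, ζ k * ζ k := by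
    rw [← rtr_conjDiag hW, ← conjDiag_mul hW, hZh, hZ]
    have : 1 * (Uᴴ * conjDiag W ζ * V) * 1 * (Vᴴ * conjDiag W ζ * U) =
        Uᴴ * (conjDiag W ζ * (V * Vᴴ) * conjDiag W ζ * U) := by
      simp only [Matrix.mul_assoc, Matrix.one_mul]
    rw [this, rtr_mul_comm, Matrix.mul_assoc _ U, unitary_mul_conjTranspose hU, Matrix.mul_one,
      unitary_mul_conjTranspose hV, Matrix.mul_one]
  have f4 : rtr (B * Zᴴ) = ∑ k, β k * ζ k := by
    rw [← rtr_conjDiag hW, ← conjDiag_mul hW, hZh, hB]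
    have : Uᴴ * conjDiag W β * V * (Vᴴ * conjDiag W ζ * U) =
        Uᴴ * (conjDiag W β * (V * Vᴴ) * conjDiag W ζ * U) := by
      simp only [Matrix.mul_assoc]
    rw [this, rtr_mul_comm, Matrix.mul_assoc _ U, unitary_mul_conjTranspose hU, Matrix.mul_one,
      unitary_mul_conjTranspose hV, Matrix.mul_one]
  rw [rtr_mul_conjTranspose] at f4
  have g := hξeq fun k => ζ k * ζ k
  rw [Matrix.add_mul, rtr_add, ← f1, ← f2, e1, e2] at g
  rw [e3] at f3
  have hsplit : ∑ i, ∑ j, (2 * (B i j * star (Z i j)).re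
      - ((x i + y j) / 2 + u) * Complex.normSq (Z i j)) =
      2 * ∑ i, ∑ j, (B i j * star (Z i j)).re
      - 1 / 2 * (∑ i, ∑ j, Complex.normSq (Z i j) * (x i * 1)
        + ∑ i, ∑ j, Complex.normSq (Z i j) * (1 * y j))
      - u * ∑ i, ∑ j, Complex.normSq (Z i j) * (1 * 1) := by
    simp only [Finset.mul_sum, ← Finset.sum_add_distrib, ← Finset.sum_sub_distrib]
    refine Finset.sum_congr rfl fun i _ => Finset.sum_congr rfl fun j _ => ?_
    ring
  rw [hsplit, f4, g, f3]
  refine le_of_eq ?_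
  simp only [Finset.mul_sum, ← Finset.sum_sub_distrib]
  refine Finset.sum_congr rfl fun k _ => ?_
  have : ξ k + u ≠ 0 := by have := hξ k; positivity
  simp only [hζ]
  field_simp
  ring

lemma sum_normSq_unitary_mul_mul {U V W : Matrix ι ι ℂ} (hU : U ∈ unitaryGroup ι ℂ)
    (hV : V ∈ unitaryGroup ι ℂ) (hW : W ∈ unitaryGroup ι ℂ) (β : ι → ℝ) :
    ∑ i, ∑ j, Complex.normSq ((Uᴴ * conjDiag W β * V) i j) = ∑ k, β k ^ 2 := by
  have h := rtr_diagonal_mul (fun _ => 1) (fun _ => 1) (Uᴴ * conjDiag W β * V)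
  have hone : (diagonal fun _ : ι => ((1 : ℝ) : ℂ)) = 1 := by simp
  rw [hone] at h
  simp only [mul_one] at h
  rw [← h]
  simp_rw [sq]
  rw [← rtr_conjDiag hW, ← conjDiag_mul hW, conjTranspose_mul, conjTranspose_mul,
    conjTranspose_conjTranspose, (conjDiag_isHermitian W β).eq]
  have : 1 * (Uᴴ * conjDiag W β * V) * (Vᴴ * (conjDiag W β * U)) =
      Uᴴ * (conjDiag W β * (V * Vᴴ) * conjDiag W β * U) := by
    simp only [Matrix.mul_assoc, Matrix.one_mul]
  rw [this, rtr_mul_comm, Matrix.mul_assoc _ U, unitary_mul_conjTranspose hU, Matrix.mul_one,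
    unitary_mul_conjTranspose hV, Matrix.mul_one]

/-- Operator Jensen inequality for the logarithm of the mean of a left and a right
multiplication. -/
lemma sum_normSq_mul_log_le {U V W : Matrix ι ι ℂ} (hU : U ∈ unitaryGroup ι ℂ)
    (hV : V ∈ unitaryGroup ι ℂ) (hW : W ∈ unitaryGroup ι ℂ) {x y β ξ : ι → ℝ}
    (hx : ∀ i, 0 < x i) (hy : ∀ i, 0 < y i) (hξ : ∀ k, 0 < ξ k)
    (hξeq : ∀ z : ι → ℝ, rtr ((conjDiag U x + conjDiag V y) * conjDiag W z) = 2 * ∑ k, ξ k * z k) :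
    ∑ i, ∑ j, Complex.normSq ((Uᴴ * conjDiag W β * V) i j) * Real.log ((x i + y j) / 2) ≤
      ∑ k, β k ^ 2 * Real.log (ξ k) := by
  set c : ι → ι → ℝ := fun i j => Complex.normSq ((Uᴴ * conjDiag W β * V) i j) with hc
  have hc0 : ∀ i j, 0 ≤ c i j := fun i j => Complex.normSq_nonneg _
  set μ : ι → ι → ℝ := fun i j => (x i + y j) / 2 with hμ
  have hμ0 : ∀ i j, 0 < μ i j := fun i j => by have := hx i; have := hy j; simp only [hμ]; positivity
  have hcsum : ∑ i, ∑ j, c i j = ∑ k, β k ^ 2 := sum_normSq_unitary_mul_mul hU hV hW β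
  set Φ : ℝ → ℝ := fun u => ∑ i, ∑ j, c i j * Real.log (μ i j + u)
    - ∑ k, β k ^ 2 * Real.log (ξ k + u) with hΦ
  have hlog : ∀ {s u : ℝ}, 0 < s → 0 ≤ u →
      HasDerivAt (fun u => Real.log (s + u)) (1 / (s + u)) u := fun hs hu =>
    ((hasDerivAt_id _).const_add _).log (by positivity)
  have hder : ∀ u ∈ Set.Ici (0 : ℝ), HasDerivAt Φ
      (∑ i, ∑ j, c i j * (1 / (μ i j + u)) - ∑ k, β k ^ 2 * (1 / (ξ k + u))) u := fun u hu =>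
    (HasDerivAt.fun_sum fun i _ => HasDerivAt.fun_sum fun j _ =>
      (hlog (hμ0 i j) hu).const_mul _).sub
      (HasDerivAt.fun_sum fun k _ => (hlog (hξ k) hu).const_mul _)
  have hmono : MonotoneOn Φ (Set.Ici 0) := by
    refine monotoneOn_of_hasDerivWithinAt_nonneg (convex_Ici 0)
      (fun u hu => (hder u hu).continuousAt.continuousWithinAt)
      (fun u hu => (hder u (interior_subset hu)).hasDerivWithinAt) fun u hu => ?_
    have h := sum_sq_div_le (β := β) hU hV hW hx hy hξ hξeq (u := u) (interior_subset hu)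
    simp only [mul_one_div, sub_nonneg]
    exact h
  have hbound : ∀ u : ℝ, 0 < u → Φ 0 * u ≤ ∑ i, ∑ j, c i j * μ i j := by
    intro u hu
    have h1 : Φ u ≤ ∑ i, ∑ j, c i j * (Real.log u + μ i j / u) - ∑ k, β k ^ 2 * Real.log u := by
      refine sub_le_sub (Finset.sum_le_sum fun i _ => Finset.sum_le_sum fun j _ => ?_)
        (Finset.sum_le_sum fun k _ => ?_)
      · refine mul_le_mul_of_nonneg_left ?_ (hc0 i j)
        have h2 : μ i j + u = u * (1 + μ i j / u) := by field_simp; ring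
        have h3 : 0 < 1 + μ i j / u := by have := hμ0 i j; positivity
        rw [h2, Real.log_mul hu.ne' h3.ne']
        have := Real.log_le_sub_one_of_pos h3
        linarith
      · refine mul_le_mul_of_nonneg_left (Real.log_le_log hu ?_) (sq_nonneg _)
        have := hξ k; linarith
    have h4 : ∑ i, ∑ j, c i j * (Real.log u + μ i j / u) - ∑ k, β k ^ 2 * Real.log u =
        (∑ i, ∑ j, c i j * μ i j) / u := by
      simp only [mul_add, Finset.sum_add_distrib, ← Finset.sum_mul, hcsum, add_sub_cancel_left,
        Finset.sum_div, mul_div_assoc]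
    have h5 : Φ 0 ≤ (∑ i, ∑ j, c i j * μ i j) / u :=
      (hmono Set.self_mem_Ici hu.le hu.le).trans (h1.trans h4.le)
    rwa [le_div_iff₀ hu] at h5
  have h0 : Φ 0 ≤ 0 := by
    by_contra! hpos
    have hS : 0 ≤ ∑ i, ∑ j, c i j * μ i j :=
      Finset.sum_nonneg fun i _ => Finset.sum_nonneg fun j _ => mul_nonneg (hc0 i j) (hμ0 i j).le
    have := hbound ((∑ i, ∑ j, c i j * μ i j + 1) / Φ 0) (by positivity)
    rw [mul_div_cancel₀ _ hpos.ne'] at this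
    linarith
  simpa [hΦ, hμ] using h0

end Entropy

section EntropySplit

variable {ι : Type*} [Fintype ι] [DecidableEq ι]

lemma sum_overlap_mul_pos {U V : Matrix ι ι ℂ} (hU : U ∈ unitaryGroup ι ℂ)
    (hV : V ∈ unitaryGroup ι ℂ) {x : ι → ℝ} (hx : ∀ i, 0 < x i) (k : ι) :
    0 < ∑ i, overlap U V i k * x i := by
  have h1 := sum_overlap_left hU hV k
  have h2 : ∃ i, overlap U V i k ≠ 0 := by
    by_contra! h
    simp [h] at h1
  obtain ⟨i, hi⟩ := h2
  exact Finset.sum_pos' (fun i _ => mul_nonneg (overlap_nonneg _ _ _ _) (hx i).le)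
    ⟨i, Finset.mem_univ _, mul_pos ((overlap_nonneg _ _ _ _).lt_of_ne' hi) (hx i)⟩

lemma rtr_mul_odd_le {P a : Matrix ι ι ℂ} (hP : IsReflection P) (ha : a.IsHermitian)
    (haP : P * a * P = a) {U W : Matrix ι ι ℂ} (hU : U ∈ unitaryGroup ι ℂ)
    (hW : W ∈ unitaryGroup ι ℂ) {x β : ι → ℝ} (hx : ∀ i, 0 < x i)
    (hbP : P * conjDiag W β * P = -conjDiag W β) (hN : 0 < rtr (a * a)) {t : ℝ} (ht : 0 < t)
    (hX : conjDiag U x = a + (t : ℂ) • conjDiag W β) :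
    rtr (conjDiag U (fun i => 4 * (x i * Real.log (x i)) + 2 * x i) * conjDiag W β) ≤
      2 * t * (∑ k, β k ^ 2 * Real.log (β k ^ 2) +
        (∑ k, β k ^ 2) * Real.log (rtr (a * a) / ∑ k, β k ^ 2) + 3 * ∑ k, β k ^ 2) := by
  set b := conjDiag W β with hb
  set φ : ι → ℝ := fun i => 4 * (x i * Real.log (x i)) + 2 * x i with hφ
  have hPU := mul_mem hP.mem_unitaryGroup hU
  have hPXP : P * conjDiag U x * P = a - (t : ℂ) • b := by
    rw [hX, Matrix.mul_add, Matrix.add_mul, haP, Matrix.mul_smul, Matrix.smul_mul, hbP]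
    simp [sub_eq_add_neg]
  have hdiff : conjDiag U x - P * conjDiag U x * P = ((2 * t : ℝ) : ℂ) • b := by
    rw [hPXP, hX]
    push_cast
    module
  have hsum : conjDiag U x + conjDiag (P * U) x = ((2 : ℝ) : ℂ) • a := by
    rw [← hP.conj_conjDiag, hPXP, hX]
    push_cast
    module
  have h1 : 2 * t * rtr (conjDiag U φ * b) =
      1 / 2 * ∑ i, ∑ j, overlap U (P * U) i j * ((φ i - φ j) * (x i - x j)) := by
    rw [← rtr_mul_sub_conj hP hU, hdiff, Matrix.mul_smul, rtr_smul]
  set B := Uᴴ * b * (P * U) with hB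
  have hent : ∀ i j, overlap U (P * U) i j * (x i - x j) ^ 2 =
      4 * t ^ 2 * Complex.normSq (B i j) := by
    have hmat : ((2 * t : ℝ) : ℂ) • B = diagonal (fun i => (x i : ℂ)) * (Uᴴ * (P * U)) -
        Uᴴ * (P * U) * diagonal (fun i => (x i : ℂ)) := by
      have e1 : ((2 * t : ℝ) : ℂ) • B = Uᴴ * (conjDiag U x - P * conjDiag U x * P) * (P * U) := by
        rw [hdiff, hB, Matrix.mul_smul, Matrix.smul_mul]
      rw [e1, Matrix.mul_sub, Matrix.sub_mul]
      have e2 : Uᴴ * conjDiag U x * (P * U) =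
          (Uᴴ * U) * diagonal (fun i => (x i : ℂ)) * (Uᴴ * (P * U)) := by
        simp only [conjDiag, Matrix.mul_assoc]
      have e3 : Uᴴ * (P * conjDiag U x * P) * (P * U) =
          Uᴴ * (P * U) * diagonal (fun i => (x i : ℂ)) * (Uᴴ * (P * P) * U) := by
        simp only [conjDiag, Matrix.mul_assoc]
      rw [e2, e3, hP.2, Matrix.mul_one, unitary_conjTranspose_mul hU, Matrix.one_mul,
        Matrix.mul_one]
    intro i j
    have h := congrArg Complex.normSq (congrFun (congrFun hmat i) j)
    rw [Matrix.sub_apply, diagonal_mul, mul_diagonal, Matrix.smul_apply, smul_eq_mul,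
      Complex.normSq_mul, Complex.normSq_ofReal, mul_comm _ (x j : ℂ), ← sub_mul,
      ← Complex.ofReal_sub, Complex.normSq_mul, Complex.normSq_ofReal] at h
    rw [overlap]
    linarith
  have h2 : ∀ i j, overlap U (P * U) i j * ((φ i - φ j) * (x i - x j)) ≤
      16 * t ^ 2 * (Complex.normSq (B i j) * Real.log ((x i + x j) / 2)) +
        24 * t ^ 2 * Complex.normSq (B i j) := by
    intro i j
    have h := mul_le_mul_of_nonneg_left (mul_log_sub_le (hx i) (hx j))
      (overlap_nonneg U (P * U) i j)
    have h' := hent i j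
    have e : overlap U (P * U) i j * ((φ i - φ j) * (x i - x j)) =
        4 * (overlap U (P * U) i j * ((x i * Real.log (x i) - x j * Real.log (x j)) * (x i - x j)))
          + 2 * (overlap U (P * U) i j * (x i - x j) ^ 2) := by simp only [hφ]; ring
    have e2 : overlap U (P * U) i j * ((x i - x j) ^ 2 * (Real.log ((x i + x j) / 2) + 1)) =
        4 * t ^ 2 * Complex.normSq (B i j) * (Real.log ((x i + x j) / 2) + 1) := by
      rw [← h']; ring
    rw [e, h']
    rw [e2] at h
    linarith
  set ξ : ι → ℝ := fun k =>
    1 / 2 * (∑ i, overlap U W i k * x i + ∑ i, overlap (P * U) W i k * x i) with hξ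
  have hξ0 : ∀ k, 0 < ξ k := fun k => by
    have := sum_overlap_mul_pos hU hW hx k
    have := sum_overlap_mul_pos hPU hW hx k
    simp only [hξ]
    positivity
  have hξeq : ∀ z : ι → ℝ,
      rtr ((conjDiag U x + conjDiag (P * U) x) * conjDiag W z) = 2 * ∑ k, ξ k * z k := by
    intro z
    have c : ∀ V : Matrix ι ι ℂ, ∑ i, ∑ j, overlap V W i j * (x i * z j) =
        ∑ k, (∑ i, overlap V W i k * x i) * z k := by
      intro V
      rw [Finset.sum_comm]
      simp_rw [Finset.sum_mul, mul_assoc]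
    rw [Matrix.add_mul, rtr_add, rtr_conjDiag_mul_conjDiag, rtr_conjDiag_mul_conjDiag, c, c,
      ← Finset.sum_add_distrib, Finset.mul_sum]
    refine Finset.sum_congr rfl fun k _ => ?_
    simp only [hξ]
    ring
  have hξN : ∑ k, ξ k ^ 2 ≤ rtr (a * a) := by
    have e := hξeq ξ
    rw [hsum, Matrix.smul_mul, rtr_smul] at e
    have e2 : rtr (conjDiag W ξ * conjDiag W ξ) = ∑ k, ξ k * ξ k := by
      rw [conjDiag_mul hW, rtr_conjDiag hW]
    have e3 := rtr_mul_self_nonneg (ha.sub (conjDiag_isHermitian W ξ))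
    rw [Matrix.sub_mul, Matrix.mul_sub, Matrix.mul_sub, rtr_sub, rtr_sub, rtr_sub,
      rtr_mul_comm (conjDiag W ξ) a, e2] at e3
    simp_rw [sq]
    linarith
  have h3 := sum_normSq_mul_log_le (β := β) hU hPU hW hx hx hξ0 hξeq
  have h4 := sum_sq_mul_log_le (β := β) hξ0 hN hξN
  have h5 := sum_normSq_unitary_mul_mul hU hPU hW β
  have h6 := Finset.sum_le_sum fun i (_ : i ∈ Finset.univ) =>
    Finset.sum_le_sum fun j (_ : j ∈ Finset.univ) => h2 i j
  simp only [Finset.sum_add_distrib, ← Finset.mul_sum] at h6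
  rw [h5] at h6
  have h7 : 2 * t * rtr (conjDiag U φ * b) ≤ 2 * t * (2 * t * (∑ k, β k ^ 2 * Real.log (β k ^ 2) +
        (∑ k, β k ^ 2) * Real.log (rtr (a * a) / ∑ k, β k ^ 2) + 3 * ∑ k, β k ^ 2)) := by
    rw [h1]
    have := mul_le_mul_of_nonneg_left (h3.trans (by linarith : _ ≤ 1 / 2 *
      (∑ k, β k ^ 2 * Real.log (β k ^ 2) +
        (∑ k, β k ^ 2) * Real.log (rtr (a * a) / ∑ k, β k ^ 2)))) (sq_nonneg t)
    linarith
  exact le_of_mul_le_mul_left h7 (by positivity)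

lemma Matrix.PosDef.exists_sub_smul_one_posSemidef {f : Matrix ι ι ℂ} (hf : f.PosDef) :
    ∃ δ : ℝ, 0 < δ ∧ (f - (δ : ℂ) • 1).PosSemidef := by
  obtain ⟨U, hU, h⟩ := hf.isHermitian.exists_eq_conjDiag
  rcases isEmpty_or_nonempty ι with he | he
  · exact ⟨1, one_pos, by rw [Subsingleton.elim (f - _) 0]; exact PosSemidef.zero⟩
  obtain ⟨i, hi⟩ := Finite.exists_min hf.isHermitian.eigenvalues
  refine ⟨_, hf.eigenvalues_pos i, ?_⟩
  nth_rewrite 1 [h]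
  rw [conjDiag_sub_const hU]
  exact conjDiag_posSemidef _ fun j => sub_nonneg.2 (hi j)

lemma Matrix.IsHermitian.exists_smul_one_sub_posSemidef {f : Matrix ι ι ℂ} (hf : f.IsHermitian) :
    ∃ R : ℝ, ((R : ℂ) • 1 - f).PosSemidef := by
  obtain ⟨U, hU, h⟩ := hf.exists_eq_conjDiag
  rcases isEmpty_or_nonempty ι with he | he
  · exact ⟨1, by rw [Subsingleton.elim (_ - f) 0]; exact PosSemidef.zero⟩
  obtain ⟨i, hi⟩ := Finite.exists_max hf.eigenvalues
  refine ⟨hf.eigenvalues i, ?_⟩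
  have e := conjDiag_sub_const hU (fun j => hf.eigenvalues j) (hf.eigenvalues i)
  have e2 := conjDiag_smul U (-1) (fun j => hf.eigenvalues j - hf.eigenvalues i)
  rw [← e] at e2
  nth_rewrite 2 [h]
  have e3 : ((hf.eigenvalues i : ℝ) : ℂ) • 1 - conjDiag U hf.eigenvalues =
      conjDiag U fun j => -1 * (hf.eigenvalues j - hf.eigenvalues i) := by
    rw [e2]; simp
  rw [e3]
  exact conjDiag_posSemidef _ fun j => by linarith [hi j]

/-- The unnormalized entropy `Tr f² log f² - Tr f² log τ(f²)` of a Hermitian matrix. -/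
noncomputable def sqEnt (f : Matrix ι ι ℂ) : ℝ :=
  specSum (fun x => x ^ 2 * Real.log (x ^ 2)) f
    - rtr (f * f) * Real.log (rtr (f * f) / Fintype.card ι)

lemma log_split_le {A B D : ℝ} (hA : 0 < A) (hB : 0 ≤ B) (hD : 0 < D) :
    B * Real.log (A / B) + B ≤
      (A + B) * Real.log ((A + B) / D) - A * Real.log (A / D) - B * Real.log (B / D) := by
  rcases hB.eq_or_lt with h | h
  · simp [← h]
  · rw [Real.log_div hA.ne' h.ne', Real.log_div (by positivity) hD.ne', Real.log_div hA.ne' hD.ne',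
      Real.log_div h.ne' hD.ne']
    have h1 := Real.log_le_sub_one_of_pos (x := A / (A + B)) (by positivity)
    rw [Real.log_div hA.ne' (by positivity)] at h1
    have h2 := mul_le_mul_of_nonneg_left h1 (by positivity : 0 ≤ A + B)
    have h3 : (A + B) * (A / (A + B) - 1) = -B := by field_simp; ring
    rw [h3] at h2
    linarith

/-- Splitting of the entropy into the even and odd parts under a reflection. -/
theorem sqEnt_add_le [Nonempty ι] {P a b : Matrix ι ι ℂ} (hP : IsReflection P)
    (ha : a.IsHermitian) (hb : b.IsHermitian) (haP : P * a * P = a) (hbP : P * b * P = -b)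
    (hab : (a + b).PosDef) : sqEnt (a + b) ≤ sqEnt a + sqEnt b + 2 * rtr (b * b) := by
  obtain ⟨δ, hδ, hδ'⟩ := hab.exists_sub_smul_one_posSemidef
  obtain ⟨R, hR⟩ := hab.isHermitian.exists_smul_one_sub_posSemidef
  set X : ℝ → Matrix ι ι ℂ := fun t => a + (t : ℂ) • b with hXdef
  have hPab : P * (a + b) * P = a - b := by
    rw [Matrix.mul_add, Matrix.add_mul, haP, hbP, sub_eq_add_neg]
  have hXH : ∀ t, (X t).IsHermitian := fun t => by
    refine ha.add ?_
    rw [IsHermitian, conjTranspose_smul, hb.eq]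
    simp
  have hX1 : ∀ t ∈ Set.Icc (0 : ℝ) 1, ∀ f : Matrix ι ι ℂ, f.PosSemidef →
      ((((1 + t) / 2 : ℝ) : ℂ) • f + (((1 - t) / 2 : ℝ) : ℂ) • (P * f * P)).PosSemidef := by
    intro t ht f hf
    have h2 : (P * f * P).PosSemidef := by
      have := hf.mul_mul_conjTranspose_same P
      rwa [hP.1.eq] at this
    refine (hf.smul ?_).add (h2.smul ?_)
    · have := ht.1
      exact_mod_cast (by positivity : 0 ≤ (1 + t) / 2)
    · have := ht.2
      exact_mod_cast (by linarith : 0 ≤ (1 - t) / 2)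
  have hXδ : ∀ t ∈ Set.Icc (0 : ℝ) 1, (X t - (δ : ℂ) • 1).PosSemidef := by
    intro t ht
    have h := hX1 t ht _ hδ'
    rw [Matrix.mul_sub, Matrix.sub_mul, hPab, Matrix.mul_smul, Matrix.mul_one, Matrix.smul_mul,
      hP.2] at h
    convert h using 1
    simp only [hXdef]
    push_cast
    module
  have hXR : ∀ t ∈ Set.Icc (0 : ℝ) 1, ((R : ℂ) • 1 - X t).PosSemidef := by
    intro t ht
    have h := hX1 t ht _ hR
    rw [Matrix.mul_sub, Matrix.sub_mul, hPab, Matrix.mul_smul, Matrix.mul_one, Matrix.smul_mul,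
      hP.2] at h
    convert h using 1
    simp only [hXdef]
    push_cast
    module
  obtain ⟨W, hW, hbW⟩ := hb.exists_eq_conjDiag
  set β := hb.eigenvalues
  have hNb : rtr (b * b) = ∑ k, β k ^ 2 := by
    rw [hbW, conjDiag_mul hW, rtr_conjDiag hW]; simp_rw [sq]
  have hNa : 0 < rtr (a * a) := by
    obtain ⟨V, hV, h⟩ := ha.exists_eq_conjDiag
    have h0 : (a - (δ : ℂ) • 1).PosSemidef := by
      have := hXδ 0 (by simp)
      simpa [hXdef] using this
    rw [h] at h0
    have h1 := le_of_conjDiag_sub_posSemidef hV h0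
    rw [h, conjDiag_mul hV, rtr_conjDiag hV]
    exact Finset.sum_pos (fun i _ => mul_pos (hδ.trans_le (h1 i)) (hδ.trans_le (h1 i)))
      Finset.univ_nonempty
  have hN : rtr ((a + b) * (a + b)) = rtr (a * a) + rtr (b * b) := by
    have e : rtr (a * b) = 0 := by
      have e1 : rtr (P * a * P * (P * b * P)) = rtr (a * b) := by
        have : P * a * P * (P * b * P) = P * (a * (P * P) * b * P) := by
          simp only [Matrix.mul_assoc]
        rw [this, rtr_mul_comm, Matrix.mul_assoc _ P, hP.2, Matrix.mul_one, Matrix.mul_one]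
      rw [haP, hbP, Matrix.mul_neg] at e1
      have : rtr (-(a * b)) = -rtr (a * b) := by simp [rtr]
      linarith
    rw [Matrix.add_mul, Matrix.mul_add, Matrix.mul_add, rtr_add, rtr_add, rtr_add,
      rtr_mul_comm b a, e]
    ring
  set θ : ℝ → ℝ := fun x => x ^ 2 * Real.log (x ^ 2) with hθ
  set κ := ∑ k, β k ^ 2 * Real.log (β k ^ 2) +
        (∑ k, β k ^ 2) * Real.log (rtr (a * a) / ∑ k, β k ^ 2) + 3 * ∑ k, β k ^ 2 with hκ
  have hder : ∀ t ∈ Set.Icc (0 : ℝ) 1, ∃ g' : ℝ,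
      HasDerivWithinAt (fun t => specSum θ (X t)) g' (Set.Icc 0 1) t ∧
        (0 < t → g' ≤ 2 * t * κ) := by
    intro t ht
    obtain ⟨U, hU, h⟩ := (hXH t).exists_eq_conjDiag
    set x := (hXH t).eigenvalues
    have hx : ∀ i, 0 < x i := fun i => by
      have h0 := hXδ t ht
      rw [h] at h0
      exact hδ.trans_le (le_of_conjDiag_sub_posSemidef hU h0 i)
    have hX' : ∀ i j, HasDerivWithinAt (fun t => X t i j) (b i j) (Set.Icc 0 1) t := by
      intro i j
      have h1 : HasDerivAt (fun t : ℝ => a i j + (t : ℂ) * b i j) (b i j) t := by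
        simpa using ((Complex.ofRealCLM.hasDerivAt (x := t)).mul_const (b i j)).const_add (a i j)
      exact h1.hasDerivWithinAt
    have hFx : ∀ i, HasDerivAt θ (4 * (x i * Real.log (x i)) + 2 * x i) (x i) := by
      intro i
      have h1 := (hasDerivAt_pow 2 (x i)).mul ((hasDerivAt_pow 2 (x i)).log (pow_pos (hx i) 2).ne')
      refine h1.congr_deriv ?_
      have := (hx i).ne'
      rw [Real.log_pow]
      field_simp
      ring
    have hd := hasDerivWithinAt_specSum (F := fun _ => θ) isOpen_univ hδ (Set.subset_univ _)
      (by
        have : ContDiffOn ℝ 2 (fun p : ℝ × ℝ => p.2 ^ 2 * Real.log (p.2 ^ 2))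
            (Set.univ ×ˢ Set.Ioi 0) := by
          refine (contDiff_snd.pow 2).contDiffOn.mul
            (ContDiffOn.log (contDiff_snd.pow 2).contDiffOn fun p hp => ?_)
          exact (pow_pos hp.2 2).ne'
        exact this) (fun t _ => hXH t) hXδ hXR ht hX' hU h (Ft := fun _ => 0)
      (fun i => hasDerivAt_const _ _) hFx
    refine ⟨_, hd, fun ht0 => ?_⟩
    have h2 := rtr_mul_odd_le (β := β) hP ha haP hU hW hx (by rw [← hbW]; exact hbP) hNa ht0
      (by rw [← hbW, ← h])
    rw [← hbW] at h2
    simpa only [Finset.sum_const_zero, add_zero] using h2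
  choose! g' hg' hg'le using hder
  have hanti : AntitoneOn (fun t => specSum θ (X t) - t ^ 2 * κ) (Set.Icc 0 1) := by
    have hd : ∀ t ∈ Set.Icc (0 : ℝ) 1, HasDerivWithinAt (fun t => specSum θ (X t) - t ^ 2 * κ)
        (g' t - 2 * t * κ) (Set.Icc 0 1) t := fun t ht => by
      refine (hg' t ht).sub ?_
      simpa using ((hasDerivAt_pow 2 t).mul_const κ).hasDerivWithinAt
    refine antitoneOn_of_hasDerivWithinAt_nonpos (convex_Icc 0 1)
      (fun t ht => (hd t ht).continuousWithinAt)
      (fun t ht => (hd t (interior_subset ht)).mono interior_subset) fun t ht => ?_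
    have h0 : 0 < t := by rw [interior_Icc] at ht; exact ht.1
    have := hg'le t (interior_subset ht) h0
    linarith
  have hfin := hanti (Set.left_mem_Icc.2 zero_le_one) (Set.right_mem_Icc.2 zero_le_one) zero_le_one
  simp only [hXdef, Complex.ofReal_one, one_smul, Complex.ofReal_zero, zero_smul, add_zero] at hfin
  have hΘb : specSum θ b = ∑ k, β k ^ 2 * Real.log (β k ^ 2) := by
    rw [hbW, specSum_conjDiag hW]
  have hlog := log_split_le hNa (B := rtr (b * b)) (D := Fintype.card ι)
    (rtr_mul_self_nonneg hb) (by exact_mod_cast Fintype.card_pos)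
  rw [sqEnt, sqEnt, sqEnt, hN, hΘb]
  rw [hNb] at hlog ⊢
  rw [hκ] at hfin
  linarith

end EntropySplit

section Twirl

variable {ι : Type*} [Fintype ι] [DecidableEq ι]

lemma conjDiag_comp_eq {U V : Matrix ι ι ℂ} (hU : U ∈ unitaryGroup ι ℂ)
    (hV : V ∈ unitaryGroup ι ℂ) {x y : ι → ℝ} (h : conjDiag U x = conjDiag V y) (F : ℝ → ℝ) :
    conjDiag U (fun i => F (x i)) = conjDiag V (fun i => F (y i)) := by
  have key : diagonal (fun i => (F (x i) : ℂ)) * (Uᴴ * V) =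
      Uᴴ * V * diagonal (fun i => (F (y i) : ℂ)) := by
    ext i j
    rw [diagonal_mul, mul_diagonal]
    rcases overlap_eq_zero_or hU hV h i j with h0 | h0
    · rw [overlap, Complex.normSq_eq_zero] at h0
      rw [h0]; simp
    · rw [h0]; ring
  have e1 : U * (diagonal (fun i => (F (x i) : ℂ)) * (Uᴴ * V)) * Vᴴ =
      conjDiag U (fun i => F (x i)) * (V * Vᴴ) := by simp only [conjDiag, Matrix.mul_assoc]
  have e2 : U * (Uᴴ * V * diagonal (fun i => (F (y i) : ℂ))) * Vᴴ =
      (U * Uᴴ) * conjDiag V (fun i => F (y i)) := by simp only [conjDiag, Matrix.mul_assoc]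
  rw [key, e2, unitary_mul_conjTranspose hU, unitary_mul_conjTranspose hV] at e1
  simpa using e1.symm

/-- A map of the form `f ↦ (f + P₀ f P₀ + P₁ f P₁ + P₂ f P₂) / 4` with reflections `Pᵢ`. -/
def IsTwirl (E : Matrix ι ι ℂ → Matrix ι ι ℂ) : Prop :=
  ∃ P : Fin 3 → Matrix ι ι ℂ, (∀ m, IsReflection (P m)) ∧
    ∀ f, E f = (((1 / 4 : ℝ)) : ℂ) • (f + ∑ m, P m * f * P m)

lemma IsTwirl.map_add {E : Matrix ι ι ℂ → Matrix ι ι ℂ} (hE : IsTwirl E) (f g : Matrix ι ι ℂ) :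
    E (f + g) = E f + E g := by
  obtain ⟨P, -, h⟩ := hE
  simp only [h, Matrix.mul_add, Matrix.add_mul, Finset.sum_add_distrib, ← smul_add]
  congr 1
  abel

lemma IsTwirl.map_smul {E : Matrix ι ι ℂ → Matrix ι ι ℂ} (hE : IsTwirl E) (c : ℂ)
    (f : Matrix ι ι ℂ) : E (c • f) = c • E f := by
  obtain ⟨P, -, h⟩ := hE
  simp only [h, Matrix.mul_smul, Matrix.smul_mul, ← Finset.smul_sum, ← smul_add]
  rw [smul_comm]

lemma IsTwirl.map_neg {E : Matrix ι ι ℂ → Matrix ι ι ℂ} (hE : IsTwirl E)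
    (f : Matrix ι ι ℂ) : E (-f) = -E f := by
  have := hE.map_smul (-1) f
  simpa using this

lemma IsTwirl.map_sub {E : Matrix ι ι ℂ → Matrix ι ι ℂ} (hE : IsTwirl E) (f g : Matrix ι ι ℂ) :
    E (f - g) = E f - E g := by
  rw [sub_eq_add_neg, hE.map_add, hE.map_neg, sub_eq_add_neg]

lemma IsTwirl.map_zero {E : Matrix ι ι ℂ → Matrix ι ι ℂ} (hE : IsTwirl E) : E 0 = 0 := by
  have := hE.map_smul 0 0
  simpa using this

/-- Spectral expression of the Dirichlet form of a twirl. -/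
lemma IsTwirl.exists_weight {E : Matrix ι ι ℂ → Matrix ι ι ℂ} (hE : IsTwirl E) {U : Matrix ι ι ℂ}
    (hU : U ∈ unitaryGroup ι ℂ) : ∃ w : ι → ι → ℝ, (∀ i j, 0 ≤ w i j) ∧ ∀ φ ψ : ι → ℝ,
      rtr (conjDiag U φ * (conjDiag U ψ - E (conjDiag U ψ))) =
        ∑ i, ∑ j, w i j * ((φ i - φ j) * (ψ i - ψ j)) := by
  obtain ⟨P, hP, h⟩ := hE
  refine ⟨fun i j => 1 / 8 * ∑ m, overlap U (P m * U) i j, fun i j => ?_, fun φ ψ => ?_⟩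
  · have := Finset.sum_nonneg fun m (_ : m ∈ Finset.univ) => overlap_nonneg U (P m * U) i j
    positivity
  have e : conjDiag U ψ - E (conjDiag U ψ) =
      ((1 / 4 : ℝ) : ℂ) • ∑ m, (conjDiag U ψ - P m * conjDiag U ψ * P m) := by
    rw [h, Finset.sum_sub_distrib]
    simp only [Finset.sum_const, Finset.card_univ, Fintype.card_fin]
    push_cast
    module
  rw [e, Matrix.mul_smul, rtr_smul, Matrix.mul_sum, rtr_sum]
  simp_rw [fun m => rtr_mul_sub_conj (hP m) hU φ ψ, Finset.mul_sum, Finset.sum_mul]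
  rw [Finset.sum_comm]
  refine Finset.sum_congr rfl fun i _ => ?_
  rw [Finset.sum_comm]
  refine Finset.sum_congr rfl fun j _ => Finset.sum_congr rfl fun m _ => ?_
  ring

lemma IsTwirl.form_abs_add_le {E : Matrix ι ι ℂ → Matrix ι ι ℂ} (hE : IsTwirl E) {U : Matrix ι ι ℂ}
    (hU : U ∈ unitaryGroup ι ℂ) (x : ι → ℝ) (ε : ℝ) :
    rtr (conjDiag U (fun i => |x i| + ε) *
      (conjDiag U (fun i => |x i| + ε) - E (conjDiag U fun i => |x i| + ε))) ≤
      rtr (conjDiag U x * (conjDiag U x - E (conjDiag U x))) := by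
  obtain ⟨w, hw, h⟩ := hE.exists_weight hU
  rw [h, h]
  refine Finset.sum_le_sum fun i _ => Finset.sum_le_sum fun j _ =>
    mul_le_mul_of_nonneg_left ?_ (hw i j)
  have := abs_mul_abs_self (x i)
  have := abs_mul_abs_self (x j)
  have := le_abs_self (x i * x j)
  rw [abs_mul] at this
  nlinarith

lemma sqEnt_conjDiag {U : Matrix ι ι ℂ} (hU : U ∈ unitaryGroup ι ℂ) (x : ι → ℝ) :
    sqEnt (conjDiag U x) = ∑ i, x i ^ 2 * Real.log (x i ^ 2) -
      (∑ i, x i ^ 2) * Real.log ((∑ i, x i ^ 2) / Fintype.card ι) := by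
  rw [sqEnt, specSum_conjDiag hU, conjDiag_mul hU, rtr_conjDiag hU]
  simp_rw [sq]

lemma sqEnt_neg {f : Matrix ι ι ℂ} (hf : f.IsHermitian) : sqEnt (-f) = sqEnt f := by
  obtain ⟨U, hU, h⟩ := hf.exists_eq_conjDiag
  have e := conjDiag_smul U (-1) hf.eigenvalues
  rw [← h] at e
  have e2 : -f = conjDiag U fun i => -1 * hf.eigenvalues i := by rw [e]; simp
  rw [e2, sqEnt_conjDiag hU]
  conv_rhs => rw [h, sqEnt_conjDiag hU]
  simp

/-- The logarithmic Sobolev inequality for the sum of the generators `1 - E k`. -/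
def HasLSI {κ : Type*} [Fintype κ] (E : κ → Matrix ι ι ℂ → Matrix ι ι ℂ) : Prop :=
  ∀ f : Matrix ι ι ℂ, f.IsHermitian → sqEnt f ≤ 2 * ∑ k, rtr (f * (f - E k f))

lemma hasLSI_of_posDef {κ : Type*} [Fintype κ] {E : κ → Matrix ι ι ℂ → Matrix ι ι ℂ}
    (hE : ∀ k, IsTwirl (E k))
    (h : ∀ f : Matrix ι ι ℂ, f.PosDef → sqEnt f ≤ 2 * ∑ k, rtr (f * (f - E k f))) : HasLSI E := by
  intro f hf
  obtain ⟨U, hU, hfU⟩ := hf.exists_eq_conjDiag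
  set x := hf.eigenvalues
  have hpos : ∀ ε : ℝ, 0 < ε → sqEnt (conjDiag U fun i => |x i| + ε) ≤
      2 * ∑ k, rtr (f * (f - E k f)) := by
    intro ε hε
    refine (h _ ?_).trans ?_
    · have hunit : IsUnit U := ⟨⟨U, Uᴴ, unitary_mul_conjTranspose hU,
        unitary_conjTranspose_mul hU⟩, rfl⟩
      refine PosDef.mul_mul_conjTranspose_same ?_ (Matrix.vecMul_injective_of_isUnit hunit)
      refine PosDef.diagonal fun i => ?_
      exact_mod_cast (by positivity : 0 < |x i| + ε)
    · refine mul_le_mul_of_nonneg_left (Finset.sum_le_sum fun k _ => ?_) zero_le_two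
      rw [hfU]
      exact (hE k).form_abs_add_le hU x ε
  have hcont : Continuous fun ε : ℝ => sqEnt (conjDiag U fun i => |x i| + ε) := by
    simp_rw [sqEnt_conjDiag hU]
    refine Continuous.sub (continuous_finsetSum _ fun i _ =>
      Real.continuous_mul_log.comp (by fun_prop : Continuous fun ε : ℝ => (|x i| + ε) ^ 2)) ?_
    rcases isEmpty_or_nonempty ι with he | he
    · simp only [Finset.univ_eq_empty, Finset.sum_empty, zero_mul]
      exact continuous_const
    have hD : (Fintype.card ι : ℝ) ≠ 0 := by exact_mod_cast Fintype.card_ne_zero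
    have e : ∀ ε : ℝ, (∑ i, (|x i| + ε) ^ 2) * Real.log ((∑ i, (|x i| + ε) ^ 2) / Fintype.card ι) =
        Fintype.card ι * ((∑ i, (|x i| + ε) ^ 2) / Fintype.card ι *
          Real.log ((∑ i, (|x i| + ε) ^ 2) / Fintype.card ι)) := fun ε => by
      field_simp
    simp_rw [e]
    exact continuous_const.mul (Real.continuous_mul_log.comp (by fun_prop))
  have hlim := (hcont.tendsto 0).mono_left (nhdsWithin_le_nhds (s := Set.Ioi 0))
  have e0 : sqEnt (conjDiag U fun i => |x i| + 0) = sqEnt f := by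
    rw [hfU, sqEnt_conjDiag hU, sqEnt_conjDiag hU]
    simp
  rw [e0] at hlim
  exact le_of_tendsto hlim (Filter.eventually_of_mem self_mem_nhdsWithin fun ε hε => hpos ε hε)

lemma hasLSI_of_unique [Unique ι] {κ : Type*} [Fintype κ] [IsEmpty κ]
    (E : κ → Matrix ι ι ℂ → Matrix ι ι ℂ) : HasLSI E := by
  intro f hf
  obtain ⟨U, hU, hfU⟩ := hf.exists_eq_conjDiag
  rw [hfU, sqEnt_conjDiag hU]
  simp

end Twirl

section Blocks

variable {ι : Type*} [Fintype ι]

lemma rtr_fromBlocks (A B C D : Matrix ι ι ℂ) : rtr (fromBlocks A B C D) = rtr A + rtr D := by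
  simp [rtr, trace, Fintype.sum_sum_type]

variable [DecidableEq ι]

lemma fromBlocks_conjDiag (U V : Matrix ι ι ℂ) (x y : ι → ℝ) :
    fromBlocks (conjDiag U x) 0 0 (conjDiag V y) =
      conjDiag (fromBlocks U 0 0 V) (Sum.elim x y) := by
  have : (diagonal fun i => ((Sum.elim x y i : ℝ) : ℂ)) =
      fromBlocks (diagonal fun i => (x i : ℂ)) 0 0 (diagonal fun i => (y i : ℂ)) := by
    rw [fromBlocks_diagonal]
    congr 1
    ext i
    cases i <;> rfl
  rw [conjDiag.eq_def (fromBlocks U 0 0 V), this, fromBlocks_conjTranspose, fromBlocks_multiply, fromBlocks_multiply]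
  simp [conjDiag]

lemma fromBlocks_mem_unitaryGroup {U V : Matrix ι ι ℂ} (hU : U ∈ unitaryGroup ι ℂ)
    (hV : V ∈ unitaryGroup ι ℂ) : fromBlocks U 0 0 V ∈ unitaryGroup (ι ⊕ ι) ℂ := by
  rw [mem_unitaryGroup_iff, star_eq_conjTranspose, fromBlocks_conjTranspose, fromBlocks_multiply]
  simp [unitary_mul_conjTranspose hU, unitary_mul_conjTranspose hV]

lemma sqEnt_fromBlocks {A B : Matrix ι ι ℂ} (hA : A.IsHermitian) (hB : B.IsHermitian)
    (h : rtr (A * A) = rtr (B * B)) :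
    sqEnt (fromBlocks A 0 0 B) = sqEnt A + sqEnt B := by
  obtain ⟨U, hU, hAU⟩ := hA.exists_eq_conjDiag
  obtain ⟨V, hV, hBV⟩ := hB.exists_eq_conjDiag
  set x := hA.eigenvalues
  set y := hB.eigenvalues
  rw [hAU, hBV, conjDiag_mul hU, conjDiag_mul hV, rtr_conjDiag hU, rtr_conjDiag hV] at h
  simp_rw [← sq] at h
  rw [hAU, hBV, fromBlocks_conjDiag, sqEnt_conjDiag (fromBlocks_mem_unitaryGroup hU hV),
    sqEnt_conjDiag hU, sqEnt_conjDiag hV]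
  simp only [Fintype.sum_sum_type, Sum.elim_inl, Sum.elim_inr, Fintype.card_sum, h]
  have : (∑ i, y i ^ 2 + ∑ i, y i ^ 2) / ((Fintype.card ι + Fintype.card ι : ℕ) : ℝ) =
      (∑ i, y i ^ 2) / Fintype.card ι := by
    push_cast
    rw [← two_mul, ← two_mul, mul_div_mul_left _ _ two_ne_zero]
  rw [this]
  ring

/-- Apply a map to each block. -/
def blockMap (E : Matrix ι ι ℂ → Matrix ι ι ℂ) (f : Matrix (ι ⊕ ι) (ι ⊕ ι) ℂ) :
    Matrix (ι ⊕ ι) (ι ⊕ ι) ℂ :=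
  fromBlocks (E f.toBlocks₁₁) (E f.toBlocks₁₂) (E f.toBlocks₂₁) (E f.toBlocks₂₂)

/-- Replace a block matrix by the block diagonal matrix with the mean of its diagonal blocks. -/
noncomputable def blockMean (f : Matrix (ι ⊕ ι) (ι ⊕ ι) ℂ) : Matrix (ι ⊕ ι) (ι ⊕ ι) ℂ :=
  fromBlocks ((1 / 2 : ℂ) • (f.toBlocks₁₁ + f.toBlocks₂₂)) 0 0
    ((1 / 2 : ℂ) • (f.toBlocks₁₁ + f.toBlocks₂₂))

lemma IsTwirl.blockMap {E : Matrix ι ι ℂ → Matrix ι ι ℂ} (hE : IsTwirl E) :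
    IsTwirl (blockMap E) := by
  obtain ⟨P, hP, h⟩ := hE
  refine ⟨fun m => fromBlocks (P m) 0 0 (P m), fun m => ⟨?_, ?_⟩, fun f => ?_⟩
  · rw [IsHermitian, fromBlocks_conjTranspose, (hP m).1.eq]
    simp
  · rw [fromBlocks_multiply, (hP m).2]
    simp
  · rw [_root_.blockMap]
    conv_rhs => rw [← fromBlocks_toBlocks f]
    simp only [h, fromBlocks_multiply, Fin.sum_univ_three, fromBlocks_add, fromBlocks_smul]
    simp

lemma isReflection_blockZ : IsReflection (fromBlocks 1 0 0 (-1) : Matrix (ι ⊕ ι) (ι ⊕ ι) ℂ) := by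
  refine ⟨?_, ?_⟩
  · rw [IsHermitian, fromBlocks_conjTranspose]; simp
  · rw [fromBlocks_multiply]; simp

lemma isReflection_blockX : IsReflection (fromBlocks 0 1 1 0 : Matrix (ι ⊕ ι) (ι ⊕ ι) ℂ) := by
  refine ⟨?_, ?_⟩
  · rw [IsHermitian, fromBlocks_conjTranspose]; simp
  · rw [fromBlocks_multiply]; simp

lemma HasLSI.sqEnt_offDiag_le {κ : Type*} [Fintype κ] {E : κ → Matrix ι ι ℂ → Matrix ι ι ℂ}
    (hE : ∀ k, IsTwirl (E k)) (h : HasLSI E) (C : Matrix ι ι ℂ) :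
    sqEnt (fromBlocks 0 C Cᴴ 0) ≤ 2 * ∑ k, rtr (fromBlocks 0 C Cᴴ 0 *
      (fromBlocks 0 C Cᴴ 0 - blockMap (E k) (fromBlocks 0 C Cᴴ 0))) := by
  set J : Matrix (ι ⊕ ι) (ι ⊕ ι) ℂ := fromBlocks 0 C Cᴴ 0 with hJ
  have hJH : J.IsHermitian := by
    rw [IsHermitian, hJ, fromBlocks_conjTranspose]; simp
  obtain ⟨U, hU, hJU⟩ := hJH.exists_eq_conjDiag
  set x := hJH.eigenvalues
  set K := conjDiag U fun i => |x i| with hK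
  set Z : Matrix (ι ⊕ ι) (ι ⊕ ι) ℂ := fromBlocks 1 0 0 (-1) with hZ
  have hZr : IsReflection Z := isReflection_blockZ
  have hZJ : conjDiag (Z * U) x = conjDiag U fun i => -1 * x i := by
    rw [← hZr.conj_conjDiag, conjDiag_smul, ← hJU, hZ, hJ, fromBlocks_multiply,
      fromBlocks_multiply, fromBlocks_smul]
    simp
  have hZK : Z * K * Z = K := by
    rw [hK, hZr.conj_conjDiag]
    have := conjDiag_comp_eq (mul_mem hZr.mem_unitaryGroup hU) hU hZJ (fun s => |s|)
    simpa using this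
  have hKb : K = fromBlocks K.toBlocks₁₁ 0 0 K.toBlocks₂₂ := by
    have e : K = fromBlocks K.toBlocks₁₁ K.toBlocks₁₂ K.toBlocks₂₁ K.toBlocks₂₂ :=
      (fromBlocks_toBlocks K).symm
    rw [e, hZ, fromBlocks_multiply, fromBlocks_multiply, fromBlocks_inj] at hZK
    obtain ⟨-, h12, h21, -⟩ := hZK
    simp only [Matrix.one_mul, Matrix.zero_mul, add_zero, Matrix.mul_zero, zero_add,
      Matrix.mul_neg, Matrix.mul_one, Matrix.neg_mul] at h12 h21
    have hz : ∀ T : Matrix ι ι ℂ, -T = T → T = 0 := fun T hT => by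
      ext i j
      exact neg_eq_self.1 (congrFun (congrFun hT i) j)
    conv_lhs => rw [e]
    rw [hz _ h12, hz _ h21]
  set A := K.toBlocks₁₁
  set B := K.toBlocks₂₂
  have hKH : K.IsHermitian := conjDiag_isHermitian _ _
  have hAB : A.IsHermitian ∧ B.IsHermitian := by
    rw [hKb, IsHermitian, fromBlocks_conjTranspose, fromBlocks_inj] at hKH
    exact ⟨hKH.1, hKH.2.2.2⟩
  have hKK : K * K = J * J := by
    rw [hJU, hK, conjDiag_mul hU, conjDiag_mul hU]
    simp_rw [abs_mul_abs_self]
  have htr : rtr (A * A) = rtr (B * B) := by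
    rw [hKb, hJ, fromBlocks_multiply, fromBlocks_multiply, fromBlocks_inj] at hKK
    have h1 := congrArg rtr hKK.1
    have h2 := congrArg rtr hKK.2.2.2
    simp only [Matrix.mul_zero, add_zero, zero_add] at h1 h2
    rw [h1, h2, rtr_mul_comm]
  have hent : sqEnt J = sqEnt K := by
    rw [hJU, hK, sqEnt_conjDiag hU, sqEnt_conjDiag hU]
    simp_rw [sq_abs]
  have hform : ∀ k, rtr (K * (K - blockMap (E k) K)) ≤ rtr (J * (J - blockMap (E k) J)) := by
    intro k
    have := (hE k).blockMap.form_abs_add_le hU x 0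
    simp only [add_zero] at this
    rwa [← hK, ← hJU] at this
  have hform2 : ∀ k, rtr (K * (K - blockMap (E k) K)) =
      rtr (A * (A - E k A)) + rtr (B * (B - E k B)) := by
    intro k
    rw [hKb, blockMap, toBlocks_fromBlocks₁₁, toBlocks_fromBlocks₁₂, toBlocks_fromBlocks₂₁,
      toBlocks_fromBlocks₂₂, (hE k).map_zero, sub_eq_add_neg, fromBlocks_neg, fromBlocks_add,
      fromBlocks_multiply, rtr_fromBlocks]
    simp [sub_eq_add_neg]
  calc sqEnt J = sqEnt A + sqEnt B := by rw [hent, hKb, sqEnt_fromBlocks hAB.1 hAB.2 htr]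
    _ ≤ 2 * ∑ k, rtr (A * (A - E k A)) + 2 * ∑ k, rtr (B * (B - E k B)) :=
        add_le_add (h A hAB.1) (h B hAB.2)
    _ = 2 * ∑ k, rtr (K * (K - blockMap (E k) K)) := by
        simp_rw [hform2, Finset.sum_add_distrib]; ring
    _ ≤ _ := mul_le_mul_of_nonneg_left (Finset.sum_le_sum fun k _ => hform k) zero_le_two

/-- Tensorization step for the logarithmic Sobolev inequality. -/
theorem HasLSI.sqEnt_blocks_le [Nonempty ι] {κ : Type*} [Fintype κ]
    {E : κ → Matrix ι ι ℂ → Matrix ι ι ℂ} (hE : ∀ k, IsTwirl (E k)) (h : HasLSI E)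
    {f : Matrix (ι ⊕ ι) (ι ⊕ ι) ℂ} (hf : f.PosDef) :
    sqEnt f ≤ 2 * (rtr (f * (f - blockMean f)) + ∑ k, rtr (f * (f - blockMap (E k) f))) := by
  obtain ⟨A, C, C', B, rfl⟩ : ∃ A C C' B, f = fromBlocks A C C' B :=
    ⟨_, _, _, _, (fromBlocks_toBlocks f).symm⟩
  have hfH := hf.isHermitian
  rw [IsHermitian, fromBlocks_conjTranspose, fromBlocks_inj] at hfH
  obtain ⟨hA, -, rfl, hB⟩ := hfH
  replace hA : A.IsHermitian := hA
  replace hB : B.IsHermitian := hB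
  obtain ⟨S, hS⟩ : ∃ S, S = (1 / 2 : ℂ) • (A + B) := ⟨_, rfl⟩
  obtain ⟨D, hD⟩ : ∃ D, D = (1 / 2 : ℂ) • (A - B) := ⟨_, rfl⟩
  have hAS : A = S + D := by rw [hS, hD]; module
  have hBS : B = S - D := by rw [hS, hD]; module
  have hSH : S.IsHermitian := by
    rw [hS, IsHermitian, conjTranspose_smul, (hA.add hB).eq]; simp
  have hDH : D.IsHermitian := by
    rw [hD, IsHermitian, conjTranspose_smul, (hA.sub hB).eq]; simp
  set Z : Matrix (ι ⊕ ι) (ι ⊕ ι) ℂ := fromBlocks 1 0 0 (-1) with hZ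
  have hZr : IsReflection Z := isReflection_blockZ
  have hfd : (fromBlocks A 0 0 B).PosDef := by
    have h1 : (Z * fromBlocks A C Cᴴ B * Z).PosDef := by
      have hu : IsUnit Z := ⟨⟨Z, Z, hZr.2, hZr.2⟩, rfl⟩
      have := hf.mul_mul_conjTranspose_same (Matrix.vecMul_injective_of_isUnit hu)
      rwa [hZr.1.eq] at this
    have h2 := (hf.add h1).smul (by norm_num : (0 : ℝ) < 1 / 2)
    convert h2 using 1
    rw [hZ, fromBlocks_multiply, fromBlocks_multiply, fromBlocks_add, fromBlocks_smul]
    simp [← two_smul ℝ, smul_smul]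
  have s1 : sqEnt (fromBlocks A C Cᴴ B) ≤ sqEnt (fromBlocks A 0 0 B) +
      sqEnt (fromBlocks 0 C Cᴴ 0) + 2 * rtr (fromBlocks 0 C Cᴴ 0 * fromBlocks 0 C Cᴴ 0) := by
    have e : fromBlocks A C Cᴴ B = fromBlocks A 0 0 B + fromBlocks 0 C Cᴴ 0 := by
      rw [fromBlocks_add]; simp
    rw [e]
    refine sqEnt_add_le hZr hfd.isHermitian ?_ ?_ ?_ ?_
    · rw [IsHermitian, fromBlocks_conjTranspose]; simp
    · rw [hZ, fromBlocks_multiply, fromBlocks_multiply]; simp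
    · rw [hZ, fromBlocks_multiply, fromBlocks_multiply, fromBlocks_neg]; simp
    · rwa [← e]
  have s2 : sqEnt (fromBlocks A 0 0 B) ≤ sqEnt (fromBlocks S 0 0 S) +
      sqEnt (fromBlocks D 0 0 (-D)) + 2 * rtr (fromBlocks D 0 0 (-D) * fromBlocks D 0 0 (-D)) := by
    have e : fromBlocks A 0 0 B = fromBlocks S 0 0 S + fromBlocks D 0 0 (-D) := by
      rw [fromBlocks_add, hAS, hBS]; simp [sub_eq_add_neg]
    rw [e]
    refine sqEnt_add_le isReflection_blockX ?_ ?_ ?_ ?_ ?_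
    · rw [IsHermitian, fromBlocks_conjTranspose, hSH.eq]; simp
    · rw [IsHermitian, fromBlocks_conjTranspose, conjTranspose_neg, hDH.eq]; simp
    · rw [fromBlocks_multiply, fromBlocks_multiply]; simp
    · rw [fromBlocks_multiply, fromBlocks_multiply, fromBlocks_neg]; simp
    · rwa [← e]
  rw [sqEnt_fromBlocks hSH hSH rfl, sqEnt_fromBlocks hDH hDH.neg (by simp), sqEnt_neg hDH] at s2
  have s3 := h.sqEnt_offDiag_le hE C
  have s4 := h S hSH
  have s5 := h D hDH
  have t1 : rtr (fromBlocks A C Cᴴ B * (fromBlocks A C Cᴴ B - blockMean (fromBlocks A C Cᴴ B))) =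
      rtr (fromBlocks D 0 0 (-D) * fromBlocks D 0 0 (-D)) +
        rtr (fromBlocks 0 C Cᴴ 0 * fromBlocks 0 C Cᴴ 0) := by
    rw [blockMean, toBlocks_fromBlocks₁₁, toBlocks_fromBlocks₂₂, ← hS, sub_eq_add_neg,
      fromBlocks_neg, fromBlocks_add, fromBlocks_multiply, fromBlocks_multiply,
      fromBlocks_multiply, rtr_fromBlocks, rtr_fromBlocks, rtr_fromBlocks, hAS, hBS]
    have c1 : S + D + -S = D := by abel
    have c2 : S - D + -S = -D := by abel
    have hn : ∀ T : Matrix ι ι ℂ, rtr (-T) = -rtr T := fun T => by simp [rtr]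
    simp only [c1, c2, neg_zero, add_zero, Matrix.mul_zero, zero_add, Matrix.add_mul,
      Matrix.sub_mul, rtr_add, rtr_sub, Matrix.mul_neg, Matrix.neg_mul, hn, neg_neg]
    ring
  have t2 : ∀ k, rtr (fromBlocks A C Cᴴ B * (fromBlocks A C Cᴴ B -
      blockMap (E k) (fromBlocks A C Cᴴ B))) = 2 * rtr (S * (S - E k S)) +
      2 * rtr (D * (D - E k D)) + rtr (fromBlocks 0 C Cᴴ 0 *
        (fromBlocks 0 C Cᴴ 0 - blockMap (E k) (fromBlocks 0 C Cᴴ 0))) := by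
    intro k
    have hE' := hE k
    simp only [blockMap, toBlocks_fromBlocks₁₁, toBlocks_fromBlocks₁₂, toBlocks_fromBlocks₂₁,
      toBlocks_fromBlocks₂₂, sub_eq_add_neg, fromBlocks_neg, fromBlocks_add, fromBlocks_multiply,
      rtr_fromBlocks, hE'.map_zero]
    rw [hAS, hBS, hE'.map_add, hE'.map_sub]
    have hn : ∀ T : Matrix ι ι ℂ, rtr (-T) = -rtr T := fun T => by simp [rtr]
    simp only [neg_zero, add_zero, Matrix.mul_zero, zero_add, Matrix.add_mul, Matrix.mul_add,
      Matrix.sub_mul, rtr_add, rtr_sub, Matrix.mul_neg, hn, neg_add_rev, neg_sub, Matrix.mul_sub]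
    ring
  rw [t1]
  simp_rw [t2, Finset.sum_add_distrib, ← Finset.mul_sum]
  linarith

end Blocks

section Qubits

variable {n : ℕ}

/-- Flip the `k`-th bit. -/
def bitFlip (k : Fin n) (x : Fin n → Fin 2) : Fin n → Fin 2 := Function.update x k (1 - x k)

lemma bitFlip_bitFlip (k : Fin n) (x : Fin n → Fin 2) : bitFlip k (bitFlip k x) = x := by
  simp [bitFlip]

lemma bitFlip_eq_comm (k : Fin n) (x y : Fin n → Fin 2) : bitFlip k x = y ↔ x = bitFlip k y :=
  ⟨fun h => by rw [← h, bitFlip_bitFlip], fun h => by rw [h, bitFlip_bitFlip]⟩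

/-- The sign of the `k`-th bit. -/
def bitSign (k : Fin n) (x : Fin n → Fin 2) : ℂ := if x k = 0 then 1 else -1

lemma bitSign_mul_self (k : Fin n) (x : Fin n → Fin 2) : bitSign k x * bitSign k x = 1 := by
  unfold bitSign; split_ifs <;> simp

lemma bitSign_bitFlip (k : Fin n) (x : Fin n → Fin 2) :
    bitSign k (bitFlip k x) = -bitSign k x := by
  simp only [bitSign, bitFlip, Function.update_self]
  generalize x k = b
  fin_cases b <;> simp

lemma star_bitSign (k : Fin n) (x : Fin n → Fin 2) : star (bitSign k x) = bitSign k x := by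
  unfold bitSign; split_ifs <;> simp

/-- The bit flip matrix with phases. -/
def flipMatrix (k : Fin n) (c : (Fin n → Fin 2) → ℂ) : Matrix (Fin n → Fin 2) (Fin n → Fin 2) ℂ :=
  Matrix.of fun x y => if bitFlip k x = y then c x else 0

lemma flipMatrix_mul_apply (k : Fin n) (c : (Fin n → Fin 2) → ℂ)
    (f : Matrix (Fin n → Fin 2) (Fin n → Fin 2) ℂ) (x y : Fin n → Fin 2) :
    (flipMatrix k c * f) x y = c x * f (bitFlip k x) y := by
  simp [flipMatrix, Matrix.mul_apply]

lemma mul_flipMatrix_apply (k : Fin n) (c : (Fin n → Fin 2) → ℂ)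
    (f : Matrix (Fin n → Fin 2) (Fin n → Fin 2) ℂ) (x y : Fin n → Fin 2) :
    (f * flipMatrix k c) x y = f x (bitFlip k y) * c (bitFlip k y) := by
  simp [flipMatrix, Matrix.mul_apply, bitFlip_eq_comm]

lemma isReflection_flipMatrix (k : Fin n) {c : (Fin n → Fin 2) → ℂ}
    (hc : ∀ x, c (bitFlip k x) = star (c x)) (hc1 : ∀ x, c x * star (c x) = 1) :
    IsReflection (flipMatrix k c) := by
  constructor
  · ext x y
    simp only [conjTranspose_apply, flipMatrix, of_apply, bitFlip_eq_comm k y x]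
    by_cases h : y = bitFlip k x
    · rw [if_pos h, if_pos h.symm, h, hc, star_star]
    · simp [h, Ne.symm h]
  · ext x y
    rw [flipMatrix_mul_apply, flipMatrix, of_apply, bitFlip_bitFlip, one_apply, hc]
    split_ifs <;> simp_all

lemma isReflection_diagonal_bitSign (k : Fin n) : IsReflection (diagonal (bitSign k)) := by
  constructor
  · rw [IsHermitian, diagonal_conjTranspose]
    congr 1
    ext x
    exact star_bitSign k x
  · rw [diagonal_mul_diagonal]
    simp [bitSign_mul_self]

lemma depolAt_zero_apply (k : Fin n) (f : Matrix (Fin n → Fin 2) (Fin n → Fin 2) ℂ)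
    (x y : Fin n → Fin 2) : depolAt 0 k f x y =
      1 / 4 * ((1 + bitSign k x * bitSign k y) * (f x y + f (bitFlip k x) (bitFlip k y))) := by
  simp only [depolAt, of_apply, bitSign, bitFlip, Fin.sum_univ_two]
  have e : ∀ z : Fin n → Fin 2, Function.update z k (z k) = z := fun z =>
    Function.update_eq_self k z
  by_cases h : x k = y k
  · simp only [h, if_true]
    have ex := e x
    have ey := e y
    rw [h] at ex
    obtain hb | hb : y k = 0 ∨ y k = 1 := by
      generalize y k = b; fin_cases b <;> simp
    · rw [hb] at ex ey ⊢
      rw [ex, ey]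
      simp
      ring
    · rw [hb] at ex ey ⊢
      rw [ex, ey]
      simp
      ring
  · have hs : (1 + (if x k = 0 then (1 : ℂ) else -1) * if y k = 0 then 1 else -1) = 0 := by
      revert h
      generalize x k = a
      generalize y k = b
      fin_cases a <;> fin_cases b <;> simp
    rw [hs]
    simp [h]

lemma isTwirl_depolAt_zero (k : Fin n) : IsTwirl (depolAt 0 k) := by
  refine ⟨![diagonal (bitSign k), flipMatrix k fun _ => 1,
    flipMatrix k fun x => Complex.I * bitSign k x], fun m => ?_, fun f => ?_⟩
  · fin_cases m
    · exact isReflection_diagonal_bitSign k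
    · exact isReflection_flipMatrix k (by simp) (by simp)
    · refine isReflection_flipMatrix k (fun x => ?_) (fun x => ?_)
      · simp only [bitSign_bitFlip, star_mul', star_bitSign]
        simp
      · have h := bitSign_mul_self k x
        simp only [star_mul', star_bitSign, Complex.star_def, Complex.conj_I]
        linear_combination h - bitSign k x * bitSign k x * Complex.I_mul_I
  · ext x y
    rw [depolAt_zero_apply]
    simp only [Fin.sum_univ_three, Matrix.smul_apply, Matrix.add_apply, mul_flipMatrix_apply,
      flipMatrix_mul_apply, mul_diagonal, diagonal_mul, bitSign_bitFlip, smul_eq_mul,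
      Matrix.cons_val_zero, Matrix.cons_val_one, Matrix.cons_val]
    push_cast
    linear_combination 1 / 4 * bitSign k x * bitSign k y * f (bitFlip k x) (bitFlip k y) *
      Complex.I_mul_I

/-- Separate the first bit. -/
def bitSplit (n : ℕ) : (Fin n → Fin 2) ⊕ (Fin n → Fin 2) ≃ (Fin (n + 1) → Fin 2) where
  toFun := Sum.elim (fun x => (Fin.cons 0 x : Fin (n + 1) → Fin 2))
    (fun x => (Fin.cons 1 x : Fin (n + 1) → Fin 2))
  invFun x := if x 0 = 0 then Sum.inl (Fin.tail x) else Sum.inr (Fin.tail x)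
  left_inv x := by
    rcases x with x | x <;> simp
  right_inv x := by
    by_cases h : x 0 = 0
    · simp only [h, if_true, Sum.elim_inl]
      rw [← h]
      exact Fin.cons_self_tail x
    · have h1 : x 0 = 1 := by omega
      simp only [h, if_false, Sum.elim_inr]
      rw [← h1]
      exact Fin.cons_self_tail x

lemma submatrix_bitSplit_depolAt_zero (f : Matrix (Fin (n + 1) → Fin 2) (Fin (n + 1) → Fin 2) ℂ) :
    (depolAt 0 0 f).submatrix (bitSplit n) (bitSplit n) =
      blockMean (f.submatrix (bitSplit n) (bitSplit n)) := by
  ext x y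
  rcases x with x | x <;> rcases y with y | y <;>
    simp [depolAt, blockMean, bitSplit, toBlocks₁₁, toBlocks₂₂, mul_add]

lemma submatrix_bitSplit_depolAt_succ (k : Fin n)
    (f : Matrix (Fin (n + 1) → Fin 2) (Fin (n + 1) → Fin 2) ℂ) :
    (depolAt 0 k.succ f).submatrix (bitSplit n) (bitSplit n) =
      blockMap (depolAt 0 k) (f.submatrix (bitSplit n) (bitSplit n)) := by
  ext x y
  rcases x with x | x <;> rcases y with y | y <;>
    simp [depolAt, blockMap, bitSplit, toBlocks₁₁, toBlocks₂₂, toBlocks₁₂, toBlocks₂₁,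
      Fin.cons_update]

lemma rtr_submatrix {ι κ : Type*} [Fintype ι] [Fintype κ] (e : ι ≃ κ) (f : Matrix κ κ ℂ) :
    rtr (f.submatrix e e) = rtr f := by
  simp only [rtr, trace, diag_apply, submatrix_apply]
  rw [e.sum_comp fun i => f i i]

lemma sqEnt_submatrix {ι κ : Type*} [Fintype ι] [Fintype κ] [DecidableEq ι] [DecidableEq κ]
    (e : ι ≃ κ) {f : Matrix κ κ ℂ} (hf : f.IsHermitian) :
    sqEnt (f.submatrix e e) = sqEnt f := by
  obtain ⟨U, hU, h⟩ := hf.exists_eq_conjDiag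
  set x := hf.eigenvalues
  have hV : U.submatrix e e ∈ unitaryGroup ι ℂ := by
    rw [mem_unitaryGroup_iff, star_eq_conjTranspose, conjTranspose_submatrix,
      submatrix_mul_equiv, unitary_mul_conjTranspose hU, submatrix_one_equiv]
  have h2 : f.submatrix e e = conjDiag (U.submatrix e e) (fun i => x (e i)) := by
    rw [h, conjDiag, conjDiag, conjTranspose_submatrix, ← submatrix_mul_equiv _ _ _ e,
      ← submatrix_mul_equiv _ _ _ e]
    congr 2
    ext i j
    simp [diagonal_apply]
  rw [h2, sqEnt_conjDiag hV, h, sqEnt_conjDiag hU, Fintype.card_congr e,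
    e.sum_comp fun i => x i ^ 2, e.sum_comp fun i => x i ^ 2 * Real.log (x i ^ 2)]

/-- The logarithmic Sobolev inequality for the depolarizing semigroup. -/
theorem hasLSI_depolAt (n : ℕ) : HasLSI fun k : Fin n => depolAt 0 k := by
  induction n with
  | zero => exact hasLSI_of_unique _
  | succ n ih =>
    refine hasLSI_of_posDef (fun k => isTwirl_depolAt_zero k) fun f hf => ?_
    have h := ih.sqEnt_blocks_le (fun k => isTwirl_depolAt_zero k)
      (f := f.submatrix (bitSplit n) (bitSplit n))
      (hf.submatrix (bitSplit n).injective)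
    rw [sqEnt_submatrix _ hf.isHermitian, ← submatrix_bitSplit_depolAt_zero] at h
    have hr : ∀ g : Matrix (Fin (n + 1) → Fin 2) (Fin (n + 1) → Fin 2) ℂ,
        rtr (f.submatrix (bitSplit n) (bitSplit n) * (f.submatrix (bitSplit n) (bitSplit n) -
          g.submatrix (bitSplit n) (bitSplit n))) = rtr (f * (f - g)) := fun g => by
      rw [← rtr_submatrix (bitSplit n) (f * (f - g)), ← submatrix_mul_equiv _ _ _ (bitSplit n)]
      rfl
    simp_rw [← submatrix_bitSplit_depolAt_succ, hr] at h
    rw [Fin.sum_univ_succ]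
    exact h

end Qubits

section Depol

variable {n : ℕ}

lemma bitFlip_comm (j k : Fin n) (x : Fin n → Fin 2) :
    bitFlip j (bitFlip k x) = bitFlip k (bitFlip j x) := by
  by_cases h : j = k
  · rw [h]
  · simp only [bitFlip, Function.update_of_ne h, Function.update_of_ne (Ne.symm h)]
    rw [Function.update_comm h]

lemma bitSign_mul_bitFlip (j k : Fin n) (x y : Fin n → Fin 2) :
    bitSign j (bitFlip k x) * bitSign j (bitFlip k y) = bitSign j x * bitSign j y := by
  by_cases h : j = k
  · rw [h, bitSign_bitFlip, bitSign_bitFlip]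
    ring
  · simp only [bitSign, bitFlip, Function.update_of_ne h]

lemma depolAt_eq (a : ℝ) (k : Fin n) (f : Matrix (Fin n → Fin 2) (Fin n → Fin 2) ℂ) :
    depolAt a k f = (a : ℂ) • f + ((1 - a : ℝ) : ℂ) • depolAt 0 k f := by
  ext x y
  simp [depolAt]

lemma depolAt_one (k : Fin n) (f : Matrix (Fin n → Fin 2) (Fin n → Fin 2) ℂ) :
    depolAt 1 k f = f := by
  rw [depolAt_eq]
  simp

lemma depolAt_apply_eq (a : ℝ) (k : Fin n) (f : Matrix (Fin n → Fin 2) (Fin n → Fin 2) ℂ)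
    (x y : Fin n → Fin 2) : depolAt a k f x y = a * f x y + (1 - a) *
      (1 / 4 * ((1 + bitSign k x * bitSign k y) * (f x y + f (bitFlip k x) (bitFlip k y)))) := by
  rw [depolAt_eq]
  simp [depolAt_zero_apply]

lemma depolAt_comm (a b : ℝ) (j k : Fin n) (f : Matrix (Fin n → Fin 2) (Fin n → Fin 2) ℂ) :
    depolAt a j (depolAt b k f) = depolAt b k (depolAt a j f) := by
  ext x y
  simp only [depolAt_apply_eq, bitSign_mul_bitFlip, bitFlip_comm j k]
  ring

lemma depolAt_depolAt (a b : ℝ) (k : Fin n) (f : Matrix (Fin n → Fin 2) (Fin n → Fin 2) ℂ) :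
    depolAt a k (depolAt b k f) = depolAt (a * b) k f := by
  ext x y
  simp only [depolAt_apply_eq, bitSign_mul_bitFlip, bitFlip_bitFlip]
  have hx := bitSign_mul_self k x
  have hy := bitSign_mul_self k y
  have h : (bitSign k x * bitSign k y) * (bitSign k x * bitSign k y) = 1 := by
    linear_combination bitSign k y * bitSign k y * hx + hy
  push_cast
  linear_combination (1 - (a : ℂ)) * (1 - b) * (f x y + f (bitFlip k x) (bitFlip k y)) / 8 * h

lemma depolAt_add (a : ℝ) (k : Fin n) (f g : Matrix (Fin n → Fin 2) (Fin n → Fin 2) ℂ) :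
    depolAt a k (f + g) = depolAt a k f + depolAt a k g := by
  ext x y
  simp only [depolAt_apply_eq, Matrix.add_apply]
  ring

lemma depolAt_smul (a : ℝ) (k : Fin n) (c : ℂ) (f : Matrix (Fin n → Fin 2) (Fin n → Fin 2) ℂ) :
    depolAt a k (c • f) = c • depolAt a k f := by
  ext x y
  simp only [depolAt_apply_eq, Matrix.smul_apply, smul_eq_mul]
  ring

lemma depolAt_one_matrix (a : ℝ) (k : Fin n) :
    depolAt a k (1 : Matrix (Fin n → Fin 2) (Fin n → Fin 2) ℂ) = 1 := by
  ext x y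
  have e : ((1 : Matrix (Fin n → Fin 2) (Fin n → Fin 2) ℂ) (bitFlip k x) (bitFlip k y)) =
      (1 : Matrix (Fin n → Fin 2) (Fin n → Fin 2) ℂ) x y := by
    simp only [one_apply, bitFlip_eq_comm, bitFlip_bitFlip]
  rw [depolAt_apply_eq, e]
  by_cases h : x = y
  · subst h
    rw [one_apply_eq, bitSign_mul_self]
    ring
  · rw [one_apply_ne h]
    ring

lemma IsTwirl.posSemidef {ι : Type*} [Fintype ι] [DecidableEq ι]
    {E : Matrix ι ι ℂ → Matrix ι ι ℂ} (hE : IsTwirl E) {f : Matrix ι ι ℂ} (hf : f.PosSemidef) :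
    (E f).PosSemidef := by
  obtain ⟨P, hP, h⟩ := hE
  rw [h]
  refine PosSemidef.smul (hf.add (posSemidef_sum _ fun m _ => ?_)) ?_
  · have := hf.mul_mul_conjTranspose_same (P m)
    rwa [(hP m).1] at this
  · norm_num [Complex.le_def]

lemma IsTwirl.rtr_mul {ι : Type*} [Fintype ι] [DecidableEq ι]
    {E : Matrix ι ι ℂ → Matrix ι ι ℂ} (hE : IsTwirl E) (f g : Matrix ι ι ℂ) :
    rtr (f * E g) = rtr (E f * g) := by
  obtain ⟨P, hP, h⟩ := hE
  rw [h, h, Matrix.mul_smul, Matrix.smul_mul, rtr_smul, rtr_smul, Matrix.mul_add, Matrix.add_mul,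
    rtr_add, rtr_add, Matrix.mul_sum, Matrix.sum_mul, rtr_sum, rtr_sum]
  congr 2
  refine Finset.sum_congr rfl fun m _ => ?_
  rw [← Matrix.mul_assoc, rtr_mul_comm]
  simp only [Matrix.mul_assoc]

lemma depolAt_posSemidef {a : ℝ} (ha : a ∈ Set.Icc (0 : ℝ) 1) (k : Fin n)
    {f : Matrix (Fin n → Fin 2) (Fin n → Fin 2) ℂ} (hf : f.PosSemidef) :
    (depolAt a k f).PosSemidef := by
  rw [depolAt_eq]
  refine (hf.smul ?_).add (((isTwirl_depolAt_zero k).posSemidef hf).smul ?_)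
  · exact_mod_cast ha.1
  · exact_mod_cast sub_nonneg.2 ha.2

lemma rtr_mul_depolAt (a : ℝ) (k : Fin n) (f g : Matrix (Fin n → Fin 2) (Fin n → Fin 2) ℂ) :
    rtr (f * depolAt a k g) = rtr (depolAt a k f * g) := by
  rw [depolAt_eq, depolAt_eq a k f, Matrix.mul_add, Matrix.add_mul, rtr_add, rtr_add,
    Matrix.mul_smul, Matrix.mul_smul, Matrix.smul_mul, Matrix.smul_mul]
  simp only [rtr_smul]
  rw [(isTwirl_depolAt_zero k).rtr_mul]

/-- The depolarizing channel applied to the qubits in a list. -/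
noncomputable def depolList (a : ℝ) (l : List (Fin n)) (f : Matrix (Fin n → Fin 2) (Fin n → Fin 2) ℂ) :
    Matrix (Fin n → Fin 2) (Fin n → Fin 2) ℂ :=
  l.foldl (fun g k => depolAt a k g) f

lemma depolList_nil (a : ℝ) (f : Matrix (Fin n → Fin 2) (Fin n → Fin 2) ℂ) :
    depolList a [] f = f := rfl

lemma depolList_concat (a : ℝ) (l : List (Fin n)) (k : Fin n)
    (f : Matrix (Fin n → Fin 2) (Fin n → Fin 2) ℂ) :
    depolList a (l ++ [k]) f = depolAt a k (depolList a l f) := by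
  simp [depolList]

lemma depolAt_depolList_comm (a b : ℝ) (l : List (Fin n)) (k : Fin n)
    (f : Matrix (Fin n → Fin 2) (Fin n → Fin 2) ℂ) :
    depolAt b k (depolList a l f) = depolList a l (depolAt b k f) := by
  induction l using List.reverseRecOn with
  | nil => rfl
  | append_singleton l j ih => rw [depolList_concat, depolList_concat, ← ih, depolAt_comm]

lemma depolList_add (a : ℝ) (l : List (Fin n)) (f g : Matrix (Fin n → Fin 2) (Fin n → Fin 2) ℂ) :
    depolList a l (f + g) = depolList a l f + depolList a l g := by
  induction l using List.reverseRecOn with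
  | nil => rfl
  | append_singleton l j ih => simp only [depolList_concat, ih, depolAt_add]

lemma depolList_smul (a : ℝ) (l : List (Fin n)) (c : ℂ)
    (f : Matrix (Fin n → Fin 2) (Fin n → Fin 2) ℂ) :
    depolList a l (c • f) = c • depolList a l f := by
  induction l using List.reverseRecOn with
  | nil => rfl
  | append_singleton l j ih => simp only [depolList_concat, ih, depolAt_smul]

lemma depolList_sub (a : ℝ) (l : List (Fin n)) (f g : Matrix (Fin n → Fin 2) (Fin n → Fin 2) ℂ) :
    depolList a l (f - g) = depolList a l f - depolList a l g := by
  have h := depolList_smul a l (-1) g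
  rw [neg_one_smul, neg_one_smul] at h
  rw [sub_eq_add_neg, depolList_add, h, ← sub_eq_add_neg]

lemma depolList_one_matrix (a : ℝ) (l : List (Fin n)) : depolList a l 1 = 1 := by
  induction l using List.reverseRecOn with
  | nil => rfl
  | append_singleton l j ih => rw [depolList_concat, ih, depolAt_one_matrix]

lemma depolList_one (l : List (Fin n)) (f : Matrix (Fin n → Fin 2) (Fin n → Fin 2) ℂ) :
    depolList 1 l f = f := by
  induction l using List.reverseRecOn with
  | nil => rfl
  | append_singleton l j ih => rw [depolList_concat, ih, depolAt_one]

lemma depolList_depolList (a b : ℝ) (l : List (Fin n))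
    (f : Matrix (Fin n → Fin 2) (Fin n → Fin 2) ℂ) :
    depolList a l (depolList b l f) = depolList (a * b) l f := by
  induction l using List.reverseRecOn with
  | nil => rfl
  | append_singleton l j ih =>
    rw [depolList_concat, depolList_concat, depolList_concat, ← depolAt_depolList_comm, ih,
      depolAt_depolAt]

lemma depolList_posSemidef {a : ℝ} (ha : a ∈ Set.Icc (0 : ℝ) 1) (l : List (Fin n))
    {f : Matrix (Fin n → Fin 2) (Fin n → Fin 2) ℂ} (hf : f.PosSemidef) :
    (depolList a l f).PosSemidef := by
  induction l using List.reverseRecOn with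
  | nil => exact hf
  | append_singleton l j ih =>
    rw [depolList_concat]
    exact depolAt_posSemidef ha j ih

lemma rtr_mul_depolList (a : ℝ) (l : List (Fin n))
    (f g : Matrix (Fin n → Fin 2) (Fin n → Fin 2) ℂ) :
    rtr (f * depolList a l g) = rtr (depolList a l f * g) := by
  induction l using List.reverseRecOn generalizing f with
  | nil => rfl
  | append_singleton l j ih =>
    rw [depolList_concat, depolList_concat, rtr_mul_depolAt, ih, depolAt_depolList_comm]

/-- The derivative of the depolarizing channel in the noise parameter, multiplied by the
parameter, is the depolarizing Laplacian. -/
lemma exists_hasDerivAt_depolList (a : ℝ) (l : List (Fin n))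
    (f : Matrix (Fin n → Fin 2) (Fin n → Fin 2) ℂ) :
    ∃ f' : Matrix (Fin n → Fin 2) (Fin n → Fin 2) ℂ,
      (∀ x y, HasDerivAt (fun a => depolList a l f x y) (f' x y) a) ∧
      (a : ℂ) • f' = (l.map fun k => depolList a l f - depolAt 0 k (depolList a l f)).sum := by
  induction l using List.reverseRecOn with
  | nil =>
    refine ⟨0, fun x y => ?_, by simp⟩
    simpa [depolList_nil] using hasDerivAt_const a (f x y)
  | append_singleton l k ih =>
    obtain ⟨f', h1, h2⟩ := ih
    set g := depolList a l f
    have ha : HasDerivAt (fun a : ℝ => (a : ℂ)) 1 a := by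
      simpa using (hasDerivAt_id a).ofReal_comp
    refine ⟨g - depolAt 0 k g + depolAt a k f', fun x y => ?_, ?_⟩
    · simp only [depolList_concat, depolAt_apply_eq]
      have := (ha.mul (h1 x y)).add ((ha.const_sub 1).mul ((((h1 x y).add
        (h1 (bitFlip k x) (bitFlip k y))).const_mul
          (1 + bitSign k x * bitSign k y)).const_mul (1 / 4)))
      refine this.congr_deriv ?_
      simp only [Matrix.add_apply, Matrix.sub_apply, depolAt_apply_eq]
      simp only [g, Pi.add_apply]
      push_cast
      ring
    · have hc : depolList a (l ++ [k]) f = depolAt a k g := depolList_concat a l k f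
      rw [hc, List.map_append, List.sum_append, smul_add, ← depolAt_smul, h2]
      have e : depolAt a k g - depolAt 0 k (depolAt a k g) = (a : ℂ) • (g - depolAt 0 k g) := by
        rw [depolAt_depolAt, zero_mul, depolAt_eq a]
        push_cast
        module
      have e2 : ∀ m : List (Fin n), depolAt a k (m.map fun j => g - depolAt 0 j g).sum =
          (m.map fun j => depolAt a k g - depolAt 0 j (depolAt a k g)).sum := fun m => by
        induction m with
        | nil =>
          have := depolAt_smul a k 0 g
          simpa using this
        | cons j m ihm =>
          simp only [List.map_cons, List.sum_cons, depolAt_add, ihm]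
          have := depolAt_smul a k (-1) (depolAt 0 j g)
          rw [neg_one_smul, neg_one_smul] at this
          rw [sub_eq_add_neg, depolAt_add, this, depolAt_comm, ← sub_eq_add_neg]
      rw [e2]
      simp only [List.map_cons, List.map_nil, List.sum_cons, List.sum_nil, add_zero, e]
      rw [add_comm]

end Depol

lemma four_mul_sq_rpow_sub_le_of_lt {q x y : ℝ} (hq0 : 0 < q) (hq1 : q < 1) (hy : 0 < y)
    (hxy : y < x) : 4 * (1 - q) * (x ^ (q / 2) - y ^ (q / 2)) ^ 2 ≤
      q ^ 2 * ((y ^ (q - 1) - x ^ (q - 1)) * (x - y)) := by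
  set I₁ := (x ^ (q / 2) - y ^ (q / 2)) / (q / 2) with hI₁
  set I₂ := (x ^ (q - 1) - y ^ (q - 1)) / (q - 1) with hI₂
  have key : ∀ c : ℝ, 0 ≤ I₂ * (c * c) + (-2 * I₁) * c + (x - y) := fun c => by
    set g : ℝ → ℝ := fun s => c ^ 2 * (s ^ (q - 1) / (q - 1)) - 2 * c * (s ^ (q / 2) / (q / 2)) + s
    have hd : ∀ s : ℝ, 0 < s → HasDerivAt g ((c * s ^ (q / 2 - 1) - 1) ^ 2) s := fun s hs => by
      have h1 := ((Real.hasDerivAt_rpow_const (p := q - 1) (Or.inl hs.ne')).div_const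
        (q - 1)).const_mul (c ^ 2)
      have h2 := ((Real.hasDerivAt_rpow_const (p := q / 2) (Or.inl hs.ne')).div_const
        (q / 2)).const_mul (2 * c)
      refine ((h1.sub h2).add (hasDerivAt_id s)).congr_deriv ?_
      have e : s ^ (q - 1 - 1) = s ^ (q / 2 - 1) * s ^ (q / 2 - 1) := by
        rw [← Real.rpow_add hs]
        ring_nf
      rw [e]
      have : q - 1 ≠ 0 := by linarith
      field_simp
      ring
    have hm : MonotoneOn g (Set.Ioi 0) := by
      refine monotoneOn_of_hasDerivWithinAt_nonneg (convex_Ioi 0)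
        (fun s hs => (hd s hs).continuousAt.continuousWithinAt) (fun s hs => ?_)
        (fun s _ => sq_nonneg (c * s ^ (q / 2 - 1) - 1))
      rw [interior_Ioi] at hs
      exact (hd s hs).hasDerivWithinAt
    have h := hm (Set.mem_Ioi.2 hy) (Set.mem_Ioi.2 (hy.trans hxy)) hxy.le
    have e : I₂ * (c * c) + (-2 * I₁) * c + (x - y) = g x - g y := by
      simp only [g, hI₁, hI₂]
      ring
    rw [e]
    exact sub_nonneg.2 h
  have h := discrim_le_zero key
  rw [discrim] at h
  have h1 : x ^ (q / 2) - y ^ (q / 2) = q / 2 * I₁ := by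
    rw [hI₁]
    field_simp
  have h2 : y ^ (q - 1) - x ^ (q - 1) = (1 - q) * I₂ := by
    have : q - 1 ≠ 0 := by linarith
    rw [hI₂]
    field_simp
    ring
  rw [h1, h2]
  have h3 : 0 ≤ q ^ 2 * (1 - q) := mul_nonneg (sq_nonneg q) (by linarith)
  nlinarith

/-- The pointwise Stroock–Varopoulos inequality for exponents in `(0, 1)`. -/
lemma four_mul_sq_rpow_sub_le {q x y : ℝ} (hq0 : 0 < q) (hq1 : q < 1) (hx : 0 < x) (hy : 0 < y) :
    4 * (1 - q) * (x ^ (q / 2) - y ^ (q / 2)) ^ 2 ≤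
      q ^ 2 * ((y ^ (q - 1) - x ^ (q - 1)) * (x - y)) := by
  rcases lt_trichotomy x y with h | h | h
  · have := four_mul_sq_rpow_sub_le_of_lt hq0 hq1 hx h
    linarith
  · simp [h]
  · exact four_mul_sq_rpow_sub_le_of_lt hq0 hq1 hy h

lemma hasDerivAt_sqrt_div {p q : ℝ} (hp : p < 1) (hq : q < 1) :
    HasDerivAt (fun q => √((1 - p) / (1 - q))) (√((1 - p) / (1 - q)) / (2 * (1 - q))) q := by
  have hq' : 0 < 1 - q := by linarith
  have hp' : 0 < 1 - p := by linarith
  have hpos : 0 < (1 - p) / (1 - q) := by positivity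
  have h := (((hasDerivAt_const q (1 - p)).div ((hasDerivAt_id q).const_sub 1) hq'.ne').sqrt
    hpos.ne')
  refine h.congr_deriv ?_
  have hs := Real.sq_sqrt hpos.le
  have hs0 : 0 < √((1 - p) / (1 - q)) := Real.sqrt_pos.2 hpos
  set w := √((1 - p) / (1 - q))
  simp only [Pi.div_apply, id]
  change _ / (2 * w) = _
  rw [eq_div_iff hq'.ne'] at hs
  field_simp
  nlinarith

section Flow

variable {n : ℕ} {A : Matrix (Fin n → Fin 2) (Fin n → Fin 2) ℂ} {δ R : ℝ}

lemma depolChannel_sub_smul_one (a c : ℝ) (A : Matrix (Fin n → Fin 2) (Fin n → Fin 2) ℂ) :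
    depolChannel a (A - (c : ℂ) • 1) = depolChannel a A - (c : ℂ) • 1 := by
  change depolList _ _ _ = depolList _ _ _ - _
  rw [depolList_sub, depolList_smul, depolList_one_matrix]

lemma depolChannel_smul_one_sub (a c : ℝ) (A : Matrix (Fin n → Fin 2) (Fin n → Fin 2) ℂ) :
    depolChannel a ((c : ℂ) • 1 - A) = (c : ℂ) • 1 - depolChannel a A := by
  change depolList _ _ _ = _ - depolList _ _ _
  rw [depolList_sub, depolList_smul, depolList_one_matrix]

lemma depolChannel_posSemidef {a : ℝ} (ha : a ∈ Set.Icc (0 : ℝ) 1) (hA : A.PosSemidef) :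
    (depolChannel a A).PosSemidef := depolList_posSemidef ha _ hA

lemma Matrix.PosSemidef.isHermitian_of_sub_smul_one {ι : Type*} [Fintype ι] [DecidableEq ι]
    {A : Matrix ι ι ℂ} {δ : ℝ} (h : (A - (δ : ℂ) • 1).PosSemidef) : A.IsHermitian := by
  have h1 := h.isHermitian.add (isHermitian_one.smul (k := (δ : ℂ)) (by simp [IsSelfAdjoint]))
  rwa [sub_add_cancel] at h1

/-- The noise parameter of the reverse hypercontractive flow. -/
noncomputable def flowParam (p q : ℝ) : ℝ := √((1 - p) / (1 - q))

lemma flowParam_mem_Icc {p q : ℝ} (hp : p < 1) (hqp : q ≤ p) : flowParam p q ∈ Set.Icc (0 : ℝ) 1 := by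
  refine ⟨Real.sqrt_nonneg _, Real.sqrt_le_one.2 ?_⟩
  rw [div_le_one (by linarith)]
  linarith

lemma flowParam_self {p : ℝ} (hp : p < 1) : flowParam p p = 1 := by
  rw [flowParam, div_self (by linarith), Real.sqrt_one]

/-- Derivative of a trace function along the flow. -/
lemma hasDerivWithinAt_specSum_flow (hδ : 0 < δ) (hA : (A - (δ : ℂ) • 1).PosSemidef)
    (hAR : ((R : ℂ) • 1 - A).PosSemidef) {F : ℝ → ℝ → ℝ} {J : Set ℝ} (hJ : IsOpen J) {l p : ℝ}
    (hp : p < 1) (hlp : Set.Icc l p ⊆ J)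
    (hF : ContDiffOn ℝ 2 (fun z : ℝ × ℝ => F z.1 z.2) (J ×ˢ Set.Ioi 0))
    {q : ℝ} (hq : q ∈ Set.Icc l p) {U : Matrix (Fin n → Fin 2) (Fin n → Fin 2) ℂ}
    (hU : U ∈ unitaryGroup (Fin n → Fin 2) ℂ) {x : (Fin n → Fin 2) → ℝ}
    (hx : depolChannel (flowParam p q) A = conjDiag U x)
    {Ft Fx : (Fin n → Fin 2) → ℝ} (hFt : ∀ i, HasDerivAt (fun t => F t (x i)) (Ft i) q)
    (hFx : ∀ i, HasDerivAt (F q) (Fx i) (x i)) :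
    HasDerivWithinAt (fun q => specSum (F q) (depolChannel (flowParam p q) A))
      (1 / (2 * (1 - q)) * ∑ k, rtr (conjDiag U Fx * (conjDiag U x - depolAt 0 k (conjDiag U x))) +
        ∑ i, Ft i) (Set.Icc l p) q := by
  obtain ⟨f', h1, h2⟩ := exists_hasDerivAt_depolList (flowParam p q) (List.finRange n) A
  have hm : ∀ t ∈ Set.Icc l p, flowParam p t ∈ Set.Icc (0 : ℝ) 1 := fun t ht =>
    flowParam_mem_Icc hp ht.2
  have hXδ : ∀ t ∈ Set.Icc l p,
      (depolChannel (flowParam p t) A - (δ : ℂ) • 1).PosSemidef := fun t ht => by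
    rw [← depolChannel_sub_smul_one]
    exact depolChannel_posSemidef (hm t ht) hA
  have hX' : ∀ i j, HasDerivWithinAt (fun t => depolChannel (flowParam p t) A i j)
      ((((flowParam p q / (2 * (1 - q)) : ℝ) : ℂ) • f') i j) (Set.Icc l p) q := fun i j => by
    have := (h1 i j).scomp q (hasDerivAt_sqrt_div hp (hq.2.trans_lt hp))
    refine (this.congr_deriv ?_).hasDerivWithinAt
    rw [Matrix.smul_apply, smul_eq_mul, Complex.real_smul]
    rfl
  have h := hasDerivWithinAt_specSum hJ hδ hlp hF
    (fun t ht => PosSemidef.isHermitian_of_sub_smul_one (hXδ t ht)) hXδ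
    (fun t ht => by
      rw [← depolChannel_smul_one_sub]
      exact depolChannel_posSemidef (hm t ht) hAR) hq hX' hU hx hFt hFx
  refine h.congr_deriv ?_
  congr 1
  have e : ((flowParam p q / (2 * (1 - q)) : ℝ) : ℂ) • f' = ((1 / (2 * (1 - q)) : ℝ) : ℂ) •
      ∑ k, (conjDiag U x - depolAt 0 k (conjDiag U x)) := by
    rw [Fin.sum_univ_def, ← hx]
    change _ = _ • (List.map (fun k => depolList (flowParam p q) (List.finRange n) A -
      depolAt 0 k (depolList (flowParam p q) (List.finRange n) A)) (List.finRange n)).sum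
    rw [← h2, smul_smul]
    congr 1
    push_cast
    ring
  rw [e, Matrix.mul_smul, rtr_smul, Matrix.mul_sum, rtr_sum]

lemma sqEnt_rpow_add_le {q : ℝ} (hq0 : 0 < q) (hq1 : q < 1)
    {U : Matrix (Fin n → Fin 2) (Fin n → Fin 2) ℂ}
    (hU : U ∈ unitaryGroup (Fin n → Fin 2) ℂ) {x : (Fin n → Fin 2) → ℝ} (hx : ∀ i, 0 < x i) :
    2 * (1 - q) * sqEnt (conjDiag U fun i => x i ^ (q / 2)) + q ^ 2 * ∑ k,
      rtr (conjDiag U (fun i => x i ^ (q - 1)) *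
        (conjDiag U x - depolAt 0 k (conjDiag U x))) ≤ 0 := by
  have h := hasLSI_depolAt n _ (conjDiag_isHermitian U fun i => x i ^ (q / 2))
  have h2 : ∀ k : Fin n, 4 * (1 - q) * rtr (conjDiag U (fun i => x i ^ (q / 2)) *
      (conjDiag U (fun i => x i ^ (q / 2)) - depolAt 0 k (conjDiag U fun i => x i ^ (q / 2)))) +
      q ^ 2 * rtr (conjDiag U (fun i => x i ^ (q - 1)) *
        (conjDiag U x - depolAt 0 k (conjDiag U x))) ≤ 0 := fun k => by
    obtain ⟨w, hw, hwe⟩ := (isTwirl_depolAt_zero k).exists_weight hU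
    rw [hwe, hwe, Finset.mul_sum, Finset.mul_sum, ← Finset.sum_add_distrib]
    refine Finset.sum_nonpos fun i _ => ?_
    rw [Finset.mul_sum, Finset.mul_sum, ← Finset.sum_add_distrib]
    refine Finset.sum_nonpos fun j _ => ?_
    have := mul_le_mul_of_nonneg_left (four_mul_sq_rpow_sub_le hq0 hq1 (hx i) (hx j)) (hw i j)
    linarith
  have h3 := Finset.sum_nonpos fun k (_ : k ∈ Finset.univ) => h2 k
  rw [Finset.sum_add_distrib, ← Finset.mul_sum, ← Finset.mul_sum] at h3
  have := mul_le_mul_of_nonneg_left h (by linarith : 0 ≤ 2 * (1 - q))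
  linarith

end Flow

section ReverseHypercontractivity

variable {n : ℕ} {A : Matrix (Fin n → Fin 2) (Fin n → Fin 2) ℂ} {δ R : ℝ}

lemma exists_depolChannel_eq_conjDiag (hδ : 0 < δ) (hA : (A - (δ : ℂ) • 1).PosSemidef) {a : ℝ}
    (ha : a ∈ Set.Icc (0 : ℝ) 1) :
    ∃ U ∈ unitaryGroup (Fin n → Fin 2) ℂ, ∃ x : (Fin n → Fin 2) → ℝ, (∀ i, 0 < x i) ∧
      depolChannel a A = conjDiag U x := by
  have h : (depolChannel a A - (δ : ℂ) • 1).PosSemidef := by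
    rw [← depolChannel_sub_smul_one]
    exact depolChannel_posSemidef ha hA
  obtain ⟨U, hU, hx⟩ := (PosSemidef.isHermitian_of_sub_smul_one h).exists_eq_conjDiag
  rw [hx] at h
  exact ⟨U, hU, _, fun i => hδ.trans_le (le_of_conjDiag_sub_posSemidef hU h i), hx⟩

/-- The logarithm of the normalized `q`-norm is nonincreasing along the flow. -/
lemma log_specSum_rpow_le (hδ : 0 < δ) (hA : (A - (δ : ℂ) • 1).PosSemidef)
    (hAR : ((R : ℂ) • 1 - A).PosSemidef) {p q : ℝ} (hq : 0 < q) (hqp : q ≤ p) (hp : p < 1) :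
    Real.log (specSum (fun x => x ^ p) A / Fintype.card (Fin n → Fin 2)) / p ≤
      Real.log (specSum (fun x => x ^ q) (depolChannel (flowParam p q) A) /
        Fintype.card (Fin n → Fin 2)) / q := by
  set D : ℝ := (Fintype.card (Fin n → Fin 2) : ℝ) with hD
  have hD0 : 0 < D := by simp [hD]
  set S : ℝ → ℝ := fun q => specSum (fun x => x ^ q) (depolChannel (flowParam p q) A)
  have key : ∀ t ∈ Set.Icc q p, ∃ y' : ℝ, y' ≤ 0 ∧
      HasDerivWithinAt (fun t => Real.log (S t / D) / t) y' (Set.Icc q p) t := by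
    intro t ht
    have ht0 : 0 < t := hq.trans_le ht.1
    have ht1 : t < 1 := ht.2.trans_lt hp
    obtain ⟨U, hU, x, hx0, hx⟩ := exists_depolChannel_eq_conjDiag hδ hA (flowParam_mem_Icc hp ht.2)
    have hS : S t = ∑ i, x i ^ t := by
      simp only [S, hx]
      rw [specSum_conjDiag hU]
    have hS0 : 0 < S t := by
      rw [hS]
      exact Finset.sum_pos (fun i _ => Real.rpow_pos_of_pos (hx0 i) t) Finset.univ_nonempty
    have hd := hasDerivWithinAt_specSum_flow (F := fun t x => x ^ t) hδ hA hAR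
      (isOpen_Ioo (a := (0 : ℝ)) (b := 1)) hp
      (fun u hu => ⟨hq.trans_le hu.1, hu.2.trans_lt hp⟩)
      (fun z hz => ((contDiffAt_snd.rpow contDiffAt_fst
        (Set.mem_Ioi.1 hz.2).ne')).contDiffWithinAt) ht hU hx
      (Ft := fun i => x i ^ t * Real.log (x i)) (Fx := fun i => t * x i ^ (t - 1))
      (fun i => (Real.hasStrictDerivAt_const_rpow (hx0 i) t).hasDerivAt)
      (fun i => Real.hasDerivAt_rpow_const (Or.inl (hx0 i).ne'))
    have hy := ((hd.div_const D).log (div_pos hS0 hD0).ne').div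
      (hasDerivWithinAt_id t (Set.Icc q p)) ht0.ne'
    refine ⟨_, ?_, hy⟩
    have hent := sqEnt_rpow_add_le ht0 ht1 hU hx0
    rw [sqEnt_conjDiag hU] at hent
    have e1 : ∀ i, (x i ^ (t / 2)) ^ 2 = x i ^ t := fun i => by
      rw [← Real.rpow_natCast, ← Real.rpow_mul (hx0 i).le]
      congr 1
      push_cast
      ring
    simp only [e1, Real.log_rpow (hx0 _)] at hent
    rw [← hS, ← hD] at hent
    rw [conjDiag_smul]
    simp only [Matrix.smul_mul, rtr_smul, ← Finset.mul_sum]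
    set L := ∑ k, rtr (conjDiag U (fun i => x i ^ (t - 1)) *
        (conjDiag U x - depolAt 0 k (conjDiag U x)))
    have e2 : ∑ i, x i ^ t * (t * Real.log (x i)) = t * ∑ i, x i ^ t * Real.log (x i) := by
      rw [Finset.mul_sum]
      exact Finset.sum_congr rfl fun i _ => by ring
    rw [e2] at hent
    set G := ∑ i, x i ^ t * Real.log (x i)
    change ((1 / (2 * (1 - t)) * (t * L) + G) / D / (S t / D) * t -
      Real.log (S t / D) * 1) / t ^ 2 ≤ 0
    refine div_nonpos_of_nonpos_of_nonneg ?_ (sq_nonneg t)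
    have h1t : 0 < 1 - t := by linarith
    have e3 : (1 / (2 * (1 - t)) * (t * L) + G) / D / (S t / D) * t - Real.log (S t / D) * 1 =
        (2 * (1 - t) * (t * G - S t * Real.log (S t / D)) + t ^ 2 * L) / (2 * (1 - t) * S t) := by
      field_simp
      ring
    rw [e3]
    exact div_nonpos_of_nonpos_of_nonneg hent (by positivity)
  choose! y' hy0 hy using key
  have h := antitoneOn_of_hasDerivWithinAt_nonpos (convex_Icc q p)
    (fun t ht => (hy t ht).continuousWithinAt)
    (fun t ht => (hy t (interior_subset ht)).mono interior_subset)
    (fun t ht => hy0 t (interior_subset ht))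
  have h2 := h (Set.left_mem_Icc.2 hqp) (Set.right_mem_Icc.2 hqp) hqp
  simp only [S, flowParam_self hp] at h2
  have e : depolChannel 1 A = A := depolList_one _ _
  rwa [e] at h2

/-- Reverse hypercontractivity of the depolarizing channel from exponent `p` to exponent `0`. -/
theorem log_specSum_rpow_le_specSum_log (hδ : 0 < δ) (hA : (A - (δ : ℂ) • 1).PosSemidef)
    (hAR : ((R : ℂ) • 1 - A).PosSemidef) {p : ℝ} (hp0 : 0 < p) (hp : p < 1) :
    Real.log (specSum (fun x => x ^ p) A / Fintype.card (Fin n → Fin 2)) / p ≤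
      specSum Real.log (depolChannel (√(1 - p)) A) / Fintype.card (Fin n → Fin 2) := by
  set D : ℝ := (Fintype.card (Fin n → Fin 2) : ℝ) with hD
  have hD0 : 0 < D := by simp [hD]
  set φ : ℝ → ℝ := fun q =>
    specSum (fun x => x ^ q * Real.log x) (depolChannel (flowParam p q) A) / D
  have hle : ∀ q ∈ Set.Ioc 0 p,
      Real.log (specSum (fun x => x ^ p) A / D) / p ≤ φ q := by
    intro q hq
    refine (log_specSum_rpow_le hδ hA hAR hq.1 hq.2 hp).trans ?_
    obtain ⟨U, hU, x, hx0, hx⟩ := exists_depolChannel_eq_conjDiag hδ hA (flowParam_mem_Icc hp hq.2)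
    simp only [φ, hx]
    rw [specSum_conjDiag hU, specSum_conjDiag hU, div_le_iff₀ hq.1, ← hD]
    have hS0 : 0 < ∑ i, x i ^ q :=
      Finset.sum_pos (fun i _ => Real.rpow_pos_of_pos (hx0 i) q) Finset.univ_nonempty
    refine (Real.log_le_sub_one_of_pos (div_pos hS0 hD0)).trans ?_
    rw [div_mul_eq_mul_div, ← sub_nonneg]
    have e : ∑ i, x i ^ q ≤ (∑ i, x i ^ q * Real.log (x i)) * q + D := by
      have e1 : D = ∑ _i : Fin n → Fin 2, (1 : ℝ) := by simp [hD]
      rw [e1, Finset.sum_mul, ← Finset.sum_add_distrib]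
      refine Finset.sum_le_sum fun i _ => ?_
      have h1 := Real.one_sub_inv_le_log_of_pos (Real.rpow_pos_of_pos (hx0 i) q)
      rw [Real.log_rpow (hx0 i)] at h1
      have h2 := mul_le_mul_of_nonneg_left h1 (Real.rpow_pos_of_pos (hx0 i) q).le
      rw [mul_sub, mul_inv_cancel₀ (Real.rpow_pos_of_pos (hx0 i) q).ne'] at h2
      linarith
    have e2 : (∑ i, x i ^ q * Real.log (x i)) * q / D - ((∑ i, x i ^ q) / D - 1) =
        ((∑ i, x i ^ q * Real.log (x i)) * q + D - ∑ i, x i ^ q) / D := by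
      field_simp
      ring
    rw [e2]
    exact div_nonneg (by linarith) hD0.le
  have hcont : ContinuousWithinAt φ (Set.Icc 0 p) 0 := by
    obtain ⟨U, hU, x, hx0, hx⟩ := exists_depolChannel_eq_conjDiag hδ hA
      (flowParam_mem_Icc hp hp0.le)
    have hd := hasDerivWithinAt_specSum_flow (F := fun t x => x ^ t * Real.log x) hδ hA hAR
      isOpen_univ hp (Set.subset_univ _)
      (fun z hz => ((contDiffAt_snd.rpow contDiffAt_fst (Set.mem_Ioi.1 hz.2).ne').mul
        (contDiffAt_snd.log (Set.mem_Ioi.1 hz.2).ne')).contDiffWithinAt)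
      (Set.left_mem_Icc.2 hp0.le) hU hx
      (Ft := fun i => x i ^ (0 : ℝ) * Real.log (x i) * Real.log (x i))
      (fun i => by simpa using ((hasDerivAt_id (0 : ℝ)).const_rpow (hx0 i)).mul_const _)
      (fun i => (Real.hasDerivAt_rpow_const (Or.inl (hx0 i).ne')).mul
        (Real.hasDerivAt_log (hx0 i).ne'))
    exact (hd.div_const D).continuousWithinAt
  have h0 : φ 0 = specSum Real.log (depolChannel (√(1 - p)) A) / D := by
    simp [φ, flowParam]
  rw [← h0]
  have ht : Filter.Tendsto φ (nhdsWithin 0 (Set.Ioc 0 p)) (nhds (φ 0)) :=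
    hcont.mono_left (nhdsWithin_mono _ Set.Ioc_subset_Icc_self)
  have : (nhdsWithin (0 : ℝ) (Set.Ioc 0 p)).NeBot := left_nhdsWithin_Ioc_neBot hp0
  exact ge_of_tendsto ht (eventually_nhdsWithin_of_forall hle)

end ReverseHypercontractivity

section TwoFunction

lemma exp_specSum_log_add_le {ι : Type*} [Fintype ι] [DecidableEq ι] [Nonempty ι]
    {U V : Matrix ι ι ℂ} (hU : U ∈ unitaryGroup ι ℂ) (hV : V ∈ unitaryGroup ι ℂ) {x y : ι → ℝ}
    (hx : ∀ i, 0 < x i) (hy : ∀ i, 0 < y i) :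
    Real.exp (specSum Real.log (conjDiag U x) / Fintype.card ι +
      specSum Real.log (conjDiag V y) / Fintype.card ι) ≤
      rtr (conjDiag U x * conjDiag V y) / Fintype.card ι := by
  have hD0 : (0 : ℝ) < Fintype.card ι := by exact_mod_cast Fintype.card_pos
  rw [specSum_conjDiag hU, specSum_conjDiag hV, rtr_conjDiag_mul_conjDiag]
  set D : ℝ := (Fintype.card ι : ℝ) with hD
  set c := (∑ i, Real.log (x i)) / D + (∑ i, Real.log (y i)) / D with hc
  have h : ∀ i j, Real.exp c * (1 + Real.log (x i) + Real.log (y j) - c) ≤ x i * y j := fun i j => by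
    have h1 := Real.add_one_le_exp (Real.log (x i) + Real.log (y j) - c)
    have h2 : x i * y j = Real.exp c * Real.exp (Real.log (x i) + Real.log (y j) - c) := by
      rw [← Real.exp_add, add_sub_cancel, Real.exp_add, Real.exp_log (hx i), Real.exp_log (hy j)]
    rw [h2]
    exact mul_le_mul_of_nonneg_left (by linarith) (Real.exp_pos c).le
  have hsum : ∑ i, ∑ j, overlap U V i j *
      (Real.exp c * (1 + Real.log (x i) + Real.log (y j) - c)) = Real.exp c * D := by
    have e : ∀ i j, overlap U V i j * (Real.exp c * (1 + Real.log (x i) + Real.log (y j) - c)) =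
        Real.exp c * (overlap U V i j * Real.log (x i)) +
          Real.exp c * (overlap U V i j * Real.log (y j)) +
          Real.exp c * (overlap U V i j * (1 - c)) := fun i j => by ring
    simp only [e, Finset.sum_add_distrib, ← Finset.mul_sum]
    rw [sum_sum_overlap_left hU hV fun i => Real.log (x i),
      sum_sum_overlap_right hU hV fun i => Real.log (y i), sum_sum_overlap_left hU hV fun _ => 1 - c]
    simp only [Finset.sum_const, Finset.card_univ, nsmul_eq_mul, ← hD]
    rw [hc]
    field_simp
    ring
  rw [le_div_iff₀ hD0, ← hsum]
  exact Finset.sum_le_sum fun i _ => Finset.sum_le_sum fun j _ =>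
    mul_le_mul_of_nonneg_left (h i j) (overlap_nonneg U V i j)

variable {n : ℕ} {M P : Matrix (Fin n → Fin 2) (Fin n → Fin 2) ℂ}

lemma log_rtr_le_specSum_log (hM0 : M.PosSemidef) (hM1 : (1 - M).PosSemidef) (hM : 0 < rtr M)
    {ε : ℝ} (hε : 0 < ε) {p : ℝ} (hp0 : 0 < p) (hp : p < 1) :
    Real.log (rtr M / Fintype.card (Fin n → Fin 2)) / p ≤
      specSum Real.log (depolChannel (√(1 - p)) (M + (ε : ℂ) • 1)) /
        Fintype.card (Fin n → Fin 2) := by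
  have hD0 : (0 : ℝ) < (Fintype.card (Fin n → Fin 2) : ℝ) := by simp
  have h := log_specSum_rpow_le_specSum_log (A := M + (ε : ℂ) • 1) (R := 1 + ε) hε
    (by simpa using hM0) (by
      have e : ((1 + ε : ℝ) : ℂ) • (1 : Matrix (Fin n → Fin 2) (Fin n → Fin 2) ℂ) -
          (M + (ε : ℂ) • 1) = 1 - M := by
        push_cast
        module
      rwa [e]) hp0 hp
  refine le_trans ?_ h
  refine div_le_div_of_nonneg_right (Real.log_le_log (div_pos hM hD0) ?_) hp0.le
  refine div_le_div_of_nonneg_right ?_ hD0.le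
  obtain ⟨U, hU, hx⟩ := hM0.isHermitian.exists_eq_conjDiag
  set x := hM0.isHermitian.eigenvalues
  rw [hx] at hM0 hM1 ⊢
  have hx0 := nonneg_of_conjDiag_posSemidef hU hM0
  have hx1 : ∀ i, x i ≤ 1 := le_of_sub_conjDiag_posSemidef hU (by simpa using hM1)
  rw [← conjDiag_const hU, ← conjDiag_add, specSum_conjDiag hU, rtr_conjDiag hU]
  refine Finset.sum_le_sum fun i _ => ?_
  calc x i = x i ^ (1 : ℝ) := (Real.rpow_one _).symm
    _ ≤ x i ^ p := by
      rcases (hx0 i).eq_or_lt with h0 | h0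
      · rw [← h0, Real.zero_rpow one_ne_zero, Real.zero_rpow hp0.ne']
      · exact Real.rpow_le_rpow_of_exponent_ge h0 (hx1 i) hp.le
    _ ≤ (x i + ε) ^ p := Real.rpow_le_rpow (hx0 i) (by linarith) hp0.le

/-- Two-function reverse hypercontractivity for effects. -/
lemma exp_log_rtr_add_le (hM0 : M.PosSemidef) (hM1 : (1 - M).PosSemidef) (hM : 0 < rtr M)
    (hP0 : P.PosSemidef) (hP1 : (1 - P).PosSemidef) (hP : 0 < rtr P)
    {p q : ℝ} (hp0 : 0 < p) (hp : p < 1) (hq0 : 0 < q) (hq : q < 1) :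
    Real.exp (Real.log (rtr M / Fintype.card (Fin n → Fin 2)) / p +
      Real.log (rtr P / Fintype.card (Fin n → Fin 2)) / q) ≤
      rtr (M * depolChannel (√(1 - p) * √(1 - q)) P) / Fintype.card (Fin n → Fin 2) := by
  set a := √(1 - p)
  set b := √(1 - q)
  have ha : a ∈ Set.Icc (0 : ℝ) 1 := ⟨Real.sqrt_nonneg _, Real.sqrt_le_one.2 (by linarith)⟩
  have hb : b ∈ Set.Icc (0 : ℝ) 1 := ⟨Real.sqrt_nonneg _, Real.sqrt_le_one.2 (by linarith)⟩
  have hle : ∀ ε ∈ Set.Ioi (0 : ℝ),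
      Real.exp (Real.log (rtr M / Fintype.card (Fin n → Fin 2)) / p +
        Real.log (rtr P / Fintype.card (Fin n → Fin 2)) / q) ≤
      (rtr (M * depolChannel (a * b) P) + ε * (rtr M + rtr (depolChannel (a * b) P)) +
        ε ^ 2 * rtr (1 : Matrix (Fin n → Fin 2) (Fin n → Fin 2) ℂ)) /
          Fintype.card (Fin n → Fin 2) := by
    intro ε hε
    obtain ⟨U, hU, x, hx0, hx⟩ := exists_depolChannel_eq_conjDiag (A := M + (ε : ℂ) • 1) hε
      (by simpa using hM0) ha
    obtain ⟨V, hV, y, hy0, hy⟩ := exists_depolChannel_eq_conjDiag (A := P + (ε : ℂ) • 1) hε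
      (by simpa using hP0) hb
    have h1 := log_rtr_le_specSum_log hM0 hM1 hM hε hp0 hp
    have h2 := log_rtr_le_specSum_log hP0 hP1 hP hε hq0 hq
    have h3 := exp_specSum_log_add_le hU hV hx0 hy0
    rw [← hx, ← hy] at h3
    refine (Real.exp_le_exp.2 (add_le_add h1 h2)).trans (h3.trans_eq ?_)
    congr 1
    have e1 : rtr (depolChannel a (M + (ε : ℂ) • 1) * depolChannel b (P + (ε : ℂ) • 1)) =
        rtr ((M + (ε : ℂ) • 1) * depolChannel (a * b) (P + (ε : ℂ) • 1)) := by
      change rtr (depolList _ _ _ * depolList _ _ _) = rtr (_ * depolList _ _ _)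
      rw [← rtr_mul_depolList, depolList_depolList]
    have e2 : depolChannel (a * b) (P + (ε : ℂ) • 1) =
        depolChannel (a * b) P + (ε : ℂ) • 1 := by
      change depolList _ _ _ = depolList _ _ _ + _
      rw [depolList_add, depolList_smul, depolList_one_matrix]
    rw [e1, e2]
    simp only [Matrix.add_mul, Matrix.mul_add, rtr_add, Matrix.mul_smul, Matrix.smul_mul, rtr_smul,
      Matrix.one_mul, Matrix.mul_one]
    ring
  have hc : Continuous fun ε : ℝ =>
      (rtr (M * depolChannel (a * b) P) + ε * (rtr M + rtr (depolChannel (a * b) P)) +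
        ε ^ 2 * rtr (1 : Matrix (Fin n → Fin 2) (Fin n → Fin 2) ℂ)) /
          Fintype.card (Fin n → Fin 2) := by fun_prop
  have ht := (hc.tendsto 0).mono_left (nhdsWithin_le_nhds (s := Set.Ioi (0 : ℝ)))
  have := ge_of_tendsto ht (eventually_nhdsWithin_of_forall hle)
  simpa using this

lemma exp_neg_le_rtr_of_pos (hM0 : M.PosSemidef) (hM1 : (1 - M).PosSemidef)
    (hP0 : P.PosSemidef) (hP1 : (1 - P).PosSemidef) {s t γ : ℝ} (hs : 0 < s) (ht : 0 < t)
    (hM : Real.exp (-(t ^ 2) / 2) ≤ rtr M / Fintype.card (Fin n → Fin 2))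
    (hP : Real.exp (-(s ^ 2) / 2) ≤ rtr P / Fintype.card (Fin n → Fin 2))
    (hγ0 : 0 < γ) (hγ1 : γ < 1) :
    Real.exp (-(1 / 2) * ((s ^ 2 + 2 * γ * s * t + t ^ 2) / (1 - γ ^ 2))) ≤
      rtr (M * depolChannel γ P) / Fintype.card (Fin n → Fin 2) := by
  have hD0 : (0 : ℝ) < (Fintype.card (Fin n → Fin 2) : ℝ) := by simp
  have hpos : ∀ {f : Matrix (Fin n → Fin 2) (Fin n → Fin 2) ℂ} {c : ℝ},
      Real.exp c ≤ rtr f / Fintype.card (Fin n → Fin 2) → 0 < rtr f := fun h => by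
    have := (Real.exp_pos _).trans_le h
    exact (div_pos_iff_of_pos_right hD0).1 this
  have hγ2 : 0 < 1 - γ ^ 2 := by nlinarith
  have hu : 0 < t + γ * s := by positivity
  have hv : 0 < s + γ * t := by positivity
  have hp : 1 - (1 - γ ^ 2) * t / (t + γ * s) = γ * (s + γ * t) / (t + γ * s) := by
    field_simp
    ring
  have hq : 1 - (1 - γ ^ 2) * s / (s + γ * t) = γ * (t + γ * s) / (s + γ * t) := by
    field_simp
    ring
  have hp0 : 0 < γ * (s + γ * t) / (t + γ * s) := by positivity
  have hq0 : 0 < γ * (t + γ * s) / (s + γ * t) := by positivity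
  have h := exp_log_rtr_add_le hM0 hM1 (hpos hM) hP0 hP1 (hpos hP)
    (p := (1 - γ ^ 2) * t / (t + γ * s)) (q := (1 - γ ^ 2) * s / (s + γ * t))
    (by positivity) (by linarith) (by positivity) (by linarith)
  have hab : √(1 - (1 - γ ^ 2) * t / (t + γ * s)) * √(1 - (1 - γ ^ 2) * s / (s + γ * t)) = γ := by
    rw [hp, hq, ← Real.sqrt_mul hp0.le]
    have : γ * (s + γ * t) / (t + γ * s) * (γ * (t + γ * s) / (s + γ * t)) = γ ^ 2 := by
      field_simp
    rw [this, Real.sqrt_sq hγ0.le]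
  rw [hab] at h
  refine le_trans (Real.exp_le_exp.2 ?_) h
  have h1 := (Real.le_log_iff_exp_le ((Real.exp_pos _).trans_le hM)).2 hM
  have h2 := (Real.le_log_iff_exp_le ((Real.exp_pos _).trans_le hP)).2 hP
  have h3 := div_le_div_of_nonneg_right h1
    (by positivity : 0 ≤ (1 - γ ^ 2) * t / (t + γ * s))
  have h4 := div_le_div_of_nonneg_right h2
    (by positivity : 0 ≤ (1 - γ ^ 2) * s / (s + γ * t))
  refine le_trans (le_of_eq ?_) (add_le_add h3 h4)
  field_simp
  ring

lemma continuous_rtr_mul_depolChannel (M P : Matrix (Fin n → Fin 2) (Fin n → Fin 2) ℂ) :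
    Continuous fun γ => rtr (M * depolChannel γ P) := by
  have h : ∀ x y, Continuous fun γ => depolChannel γ P x y := fun x y =>
    continuous_iff_continuousAt.2 fun γ => by
      obtain ⟨f', hf, -⟩ := exists_hasDerivAt_depolList γ (List.finRange n) P
      exact (hf x y).continuousAt
  simp only [rtr, trace, diag_apply, Matrix.mul_apply]
  refine Complex.continuous_re.comp ?_
  exact continuous_finsetSum _ fun x _ => continuous_finsetSum _ fun y _ =>
    continuous_const.mul (h y x)

/-- Two-function reverse hypercontractivity for effects of given traces. -/
theorem exp_neg_le_rtr_mul_depolChannel (hM0 : M.PosSemidef) (hM1 : (1 - M).PosSemidef)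
    (hP0 : P.PosSemidef) (hP1 : (1 - P).PosSemidef) {s t γ : ℝ} (hs : 0 ≤ s) (ht : 0 ≤ t)
    (hM : Real.exp (-(t ^ 2) / 2) ≤ rtr M / Fintype.card (Fin n → Fin 2))
    (hP : Real.exp (-(s ^ 2) / 2) ≤ rtr P / Fintype.card (Fin n → Fin 2))
    (hγ0 : 0 ≤ γ) (hγ1 : γ < 1) :
    Real.exp (-(1 / 2) * ((s ^ 2 + 2 * γ * s * t + t ^ 2) / (1 - γ ^ 2))) ≤
      rtr (M * depolChannel γ P) / Fintype.card (Fin n → Fin 2) := by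
  set g : ℝ → ℝ := fun d => γ + d * (1 - γ)
  set G : ℝ → ℝ := fun d => Real.exp (-(1 / 2) *
    (((s + d) ^ 2 + 2 * g d * (s + d) * (t + d) + (t + d) ^ 2) / (1 - g d ^ 2)))
  set H : ℝ → ℝ := fun d => rtr (M * depolChannel (g d) P) / Fintype.card (Fin n → Fin 2)
  have hg : Continuous g := by fun_prop
  have hle : ∀ d ∈ Set.Ioo (0 : ℝ) 1, G d ≤ H d := by
    intro d hd
    have hexp : ∀ r : ℝ, 0 ≤ r → Real.exp (-((r + d) ^ 2) / 2) ≤ Real.exp (-(r ^ 2) / 2) :=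
      fun r hr => Real.exp_le_exp.2 (by nlinarith [hd.1])
    refine exp_neg_le_rtr_of_pos hM0 hM1 hP0 hP1 (by linarith [hd.1]) (by linarith [hd.1])
      ((hexp t ht).trans hM) ((hexp s hs).trans hP) ?_ ?_
    · have := mul_pos hd.1 (sub_pos.2 hγ1)
      linarith
    · have := mul_pos (sub_pos.2 hd.2) (sub_pos.2 hγ1)
      simp only [g]
      linarith
  have hG : ContinuousAt G 0 := by
    have h0 : 1 - g 0 ^ 2 ≠ 0 := by
      simp only [g]
      nlinarith
    refine Real.continuous_exp.continuousAt.comp (continuousAt_const.mul (ContinuousAt.div ?_ ?_ h0))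
    · exact Continuous.continuousAt (by fun_prop)
    · exact Continuous.continuousAt (by fun_prop)
  have hH : ContinuousAt H 0 :=
    (((continuous_rtr_mul_depolChannel M P).comp hg).div_const _).continuousAt
  have : (nhdsWithin (0 : ℝ) (Set.Ioo 0 1)).NeBot := left_nhdsWithin_Ioo_neBot one_pos
  have h := le_of_tendsto_of_tendsto (hG.tendsto.mono_left nhdsWithin_le_nhds)
    (hH.tendsto.mono_left nhdsWithin_le_nhds)
    (eventually_nhdsWithin_of_forall (s := Set.Ioo (0 : ℝ) 1) hle)
  simpa [G, H, g] using h

end TwoFunction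

/-- Rapid mixing for large subspaces. Here `P` is the orthogonal
projector onto a subspace `S` of the `n`-qubit space with
`dim S = Tr P = e^{−s²/2} 2^n`, and `ρ` is the maximally mixed state on `S`. -/
theorem rapid_mixing
    (n : ℕ) (hn : 1 ≤ n)
    (P : Matrix (Fin n → Fin 2) (Fin n → Fin 2) ℂ)
    (hP : P.IsHermitian) (hPproj : P * P = P)
    (s : ℝ) (hs : 0 ≤ s)
    (hdim : P.trace = ((Real.exp (-(s^2)/2) * 2^n : ℝ) : ℂ))
    (M : Matrix (Fin n → Fin 2) (Fin n → Fin 2) ℂ)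
    (hM0 : M.PosSemidef) (hM1 : (1 - M).PosSemidef)
    (t : ℝ) (ht : 0 ≤ t) (hMtr : ntrace M = Real.exp (-(t^2)/2))
    (γ : ℝ) (hγ0 : 0 ≤ γ) (hγ1 : γ < 1)
    (ρ : Matrix (Fin n → Fin 2) (Fin n → Fin 2) ℂ)
    (hρ : ρ = ((Real.exp (-(s^2)/2) * 2^n : ℝ) : ℂ)⁻¹ • P) :
    Real.exp (-(1/2) * ((s^2 + 2*γ*s*t + t^2) / (1 - γ^2) - s^2)) ≤
      (M * depolChannel γ ρ).trace.re := by
  have hcard : (Fintype.card (Fin n → Fin 2) : ℝ) = 2 ^ n := by simp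
  have hP0 : P.PosSemidef := by
    have := posSemidef_conjTranspose_mul_self P
    rwa [hP.eq, hPproj] at this
  have hP1 : (1 - P).PosSemidef := by
    have := posSemidef_conjTranspose_mul_self (1 - P)
    have e : (1 - P)ᴴ * (1 - P) = 1 - P := by
      rw [conjTranspose_sub, conjTranspose_one, hP.eq, Matrix.sub_mul, Matrix.mul_sub,
        Matrix.mul_sub, hPproj]
      simp
    rwa [e] at this
  have h := exp_neg_le_rtr_mul_depolChannel hM0 hM1 hP0 hP1 hs ht hMtr.ge
    (by rw [rtr, hdim, Complex.ofReal_re, hcard, mul_div_cancel_right₀ _ (by positivity)]) hγ0 hγ1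
  rw [hcard, le_div_iff₀ (by positivity)] at h
  have e : (M * depolChannel γ ρ).trace.re =
      (Real.exp (-(s ^ 2) / 2) * 2 ^ n)⁻¹ * rtr (M * depolChannel γ P) := by
    have e1 : depolChannel γ ρ =
        (((Real.exp (-(s ^ 2) / 2) * 2 ^ n)⁻¹ : ℝ) : ℂ) • depolChannel γ P := by
      rw [hρ, Complex.ofReal_inv]
      exact depolList_smul _ _ _ _
    rw [e1, Matrix.mul_smul]
    exact rtr_smul _ _
  rw [e, inv_mul_eq_div, le_div_iff₀ (by positivity), ← mul_assoc, ← Real.exp_add]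
  refine le_trans (le_of_eq ?_) h
  congr 2
  ring
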